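/- arXiv:1611.08263 — 2 statements merged into one kernel-verified Lean document; each statement's English description precedes it below -/
import Mathlib

section
/- Every von Neumann algebra W has the uniform Dixmier property with constants (m, γ) for m = 2 and every γ ∈ (1/2, 1): for every γ ∈ (1/2, 1) and every self-adjoint g ∈ W there exist a central element z ∈ Z(W) and unitaries u_1, u_2 ∈ W such that ‖(1/2)(u_1 g u_1* + u_2 g u_2*) − z‖ ≤ γ‖g‖. -/
noncomputable section

variable {H : Type*} [NormedAddCommGroup H] [InnerProductSpace ℂ H] [CompleteSpace H]

/-- Some partial reflection `u` in `S` with `u ^ 2 = s` averages `g` into the order interval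
`[a, b]`, up to a central element `τ` of `S` lying between `lo` and `hi`. -/
def ReflectionBound {A : Type*} [CStarAlgebra A] [PartialOrder A] (S : StarSubalgebra ℂ A)
    (a b lo hi : ℝ) (s g : A) : Prop :=
  ∃ u ∈ S, ∃ τ ∈ S, (∀ x ∈ S, τ * x = x * τ) ∧ star u = u ∧ u * u = s ∧ s * u = u ∧
    s * g = g ∧ g * s = g ∧ lo • 1 ≤ τ ∧ τ ≤ hi • 1 ∧
    a • s + τ * s ≤ g + u * g * u ∧ g + u * g * u ≤ b • s + τ * s

namespace ReflectionBound

variable {A : Type*} [CStarAlgebra A] [PartialOrder A] [StarOrderedRing A]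
  {S : StarSubalgebra ℂ A} {a b lo hi : ℝ} {s g : A}

theorem mono (h : ReflectionBound S a b lo hi s g) {lo' hi' : ℝ} (hlo : lo' ≤ lo)
    (hhi : hi ≤ hi') :
    ReflectionBound S a b lo' hi' s g := by
  obtain ⟨u, hu, τ, hτ, hc, h1, h2, h3, hg, hg', h4, h5, h6⟩ := h
  exact ⟨u, hu, τ, hτ, hc, h1, h2, h3, hg, hg',
    (smul_le_smul_of_nonneg_right hlo zero_le_one).trans h4,
    h5.trans (smul_le_smul_of_nonneg_right hhi zero_le_one), h6⟩

theorem of_scalar {q : A} (hq : IsStarProjection q) (hqS : q ∈ S) {t : ℝ} (ha : a ≤ t)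
    (hb : t ≤ b) : ReflectionBound S a b t t q (t • q) := by
  have h1 : ((t • q : A) + q * (t • q) * q) = t • q + (t • 1) * q := by
    simp [hq.isIdempotentElem.eq]
  refine ⟨q, hqS, t • 1, ?_, ?_, hq.isSelfAdjoint, hq.isIdempotentElem, hq.isIdempotentElem,
    by simp [hq.isIdempotentElem.eq], by simp [hq.isIdempotentElem.eq], le_rfl, le_rfl, ?_, ?_⟩
  · have := S.smul_mem (one_mem S) (t : ℂ)
    simpa using this
  · simp
  · rw [h1]; gcongr; exact hq.nonneg
  · rw [h1]; gcongr; exact hq.nonneg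

theorem add_of_central {s₁ g₁ s₂ g₂ z : A} (h₁ : ReflectionBound S a b lo hi s₁ g₁)
    (h₂ : ReflectionBound S a b lo hi s₂ g₂) (hz : IsStarProjection z) (hzS : z ∈ S)
    (hzc : ∀ x ∈ S, z * x = x * z) (hg₁ : g₁ ∈ S) (hg₂ : g₂ ∈ S)
    (hs₁ : z * s₁ = s₁) (hs₂ : z * s₂ = 0) (hzg₁ : z * g₁ = g₁) (hzg₂ : z * g₂ = 0) :
    ReflectionBound S a b lo hi (s₁ + s₂) (g₁ + g₂) := by
  obtain ⟨u, hu, τ, hτ, hc, hus, huu, hsu, hsg, hgs, hlo, hhi, ha, hb⟩ := h₁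
  obtain ⟨v, hv, σ, hσ, hd, hvs, hvv, hsv, hsg', hgs', hlo', hhi', ha', hb'⟩ := h₂
  have hzz := hz.isIdempotentElem.eq
  have zu : z * u = u := by rw [← hsu, ← mul_assoc, hs₁]
  have zv : z * v = 0 := by rw [← hsv, ← mul_assoc, hs₂, zero_mul]
  have key : ∀ x ∈ S, ∀ y ∈ S, z * x = x → z * y = 0 → x * y = 0 ∧ y * x = 0 := by
    intro x hx y hy h1 h2
    refine ⟨?_, ?_⟩
    · rw [← h1, hzc x hx, mul_assoc, h2, mul_zero]
    · rw [← h1, ← mul_assoc, ← hzc y hy, h2, zero_mul]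
  obtain ⟨uv, vu⟩ := key u hu v hv zu zv
  obtain ⟨ug, gu⟩ := key u hu g₂ hg₂ zu hzg₂
  obtain ⟨gv, vg⟩ := key g₁ hg₁ v hv hzg₁ zv
  have su : s₂ * u = 0 := by rw [← hvv, mul_assoc, vu, mul_zero]
  have sv : s₁ * v = 0 := by rw [← huu, mul_assoc, uv, mul_zero]
  have hw : ∀ x ∈ S, (1 - z) * x = x * (1 - z) := fun x hx ↦ by
    rw [sub_mul, mul_sub, hzc x hx, one_mul, mul_one]
  have hcon : ∀ x ∈ S, z * x * z + (1 - z) * x * (1 - z) = x := fun x hx ↦ by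
    rw [mul_assoc, mul_assoc, ← hw x hx, ← hzc x hx, ← mul_assoc, ← mul_assoc, hzz,
      hz.one_sub.isIdempotentElem.eq, sub_mul, one_mul]; abel
  have hcomb : ∀ x₁ x₂ y₁ y₂ : A, x₁ ≤ y₁ → x₂ ≤ y₂ →
      z * x₁ * z + (1 - z) * x₂ * (1 - z) ≤ z * y₁ * z + (1 - z) * y₂ * (1 - z) :=
    fun x₁ x₂ y₁ y₂ h1 h2 ↦ add_le_add (hz.isSelfAdjoint.conjugate_le_conjugate h1)
      (hz.one_sub.isSelfAdjoint.conjugate_le_conjugate h2)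
  have hone : ∀ r : ℝ, (r • (1 : A)) ∈ S := fun r ↦ by
    have := S.smul_mem (one_mem S) (r : ℂ)
    simpa using this
  have hwS : 1 - z ∈ S := sub_mem (one_mem S) hzS
  have hτs : (z * τ * z + (1 - z) * σ * (1 - z)) * (s₁ + s₂) = τ * s₁ + σ * s₂ := by
    have e1 : z * (s₁ + s₂) = s₁ := by rw [mul_add, hs₁, hs₂, add_zero]
    have e2 : (1 - z) * (s₁ + s₂) = s₂ := by rw [sub_mul, e1]; simp
    rw [add_mul, mul_assoc, e1, mul_assoc _ _ (s₁ + s₂), e2, hzc τ hτ, mul_assoc, hs₁, hw σ hσ,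
      mul_assoc, sub_mul 1 z s₂, hs₂, sub_zero, one_mul]
  have hgu : g₁ + g₂ + (u + v) * (g₁ + g₂) * (u + v) =
      (g₁ + u * g₁ * u) + (g₂ + v * g₂ * v) := by
    simp only [mul_add, add_mul, ug, vg, mul_assoc, gu, gv, mul_zero, add_zero, zero_add]
    abel
  have sg₂ : s₁ * g₂ = 0 := by rw [← huu, mul_assoc, ug, mul_zero]
  have sg₁ : s₂ * g₁ = 0 := by rw [← hvv, mul_assoc, vg, mul_zero]
  have gs₂ : g₁ * s₂ = 0 := by rw [← hvv, ← mul_assoc, gv, zero_mul]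
  have gs₁ : g₂ * s₁ = 0 := by rw [← huu, ← mul_assoc, gu, zero_mul]
  refine ⟨u + v, add_mem hu hv, z * τ * z + (1 - z) * σ * (1 - z), ?_, ?_, ?_, ?_, ?_, ?_, ?_,
    ?_, ?_, ?_, ?_⟩
  · exact add_mem (mul_mem (mul_mem hzS hτ) hzS) (mul_mem (mul_mem hwS hσ) hwS)
  · intro x hx
    have cz : Commute z x := hzc x hx
    have cw : Commute (1 - z) x := hw x hx
    have ct : Commute τ x := hc x hx
    have cs : Commute σ x := hd x hx
    exact ((cz.mul_left ct).mul_left cz).add_left ((cw.mul_left cs).mul_left cw)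
  · rw [star_add, hus, hvs]
  · simp [mul_add, add_mul, uv, vu, huu, hvv]
  · simp [mul_add, add_mul, hsu, hsv, su, sv]
  · simp [mul_add, add_mul, hsg, hsg', sg₁, sg₂]
  · simp [mul_add, add_mul, hgs, hgs', gs₁, gs₂]
  · rw [← hcon _ (hone lo)]; exact hcomb _ _ _ _ hlo hlo'
  · rw [← hcon _ (hone hi)]; exact hcomb _ _ _ _ hhi hhi'
  · rw [hτs, hgu, smul_add, add_add_add_comm]; exact add_le_add ha ha'
  · rw [hτs, hgu, smul_add, add_add_add_comm (b • s₁)]; exact add_le_add hb hb'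

theorem add_of_swap {e v x : A} (h : ReflectionBound S a b lo hi s g) {c : ℝ}
    (hv : v ∈ S) (hvs : star v = v) (hvv : v * v = e) (hev : e * v = v)
    (hes : e * s = 0) (he : IsStarProjection e)
    (hx : e * x = x) (hx' : x * e = x) (hxv : x + v * x * v = c • e)
    (hac : a + hi ≤ c) (hcb : c ≤ b + lo) :
    ReflectionBound S a b lo hi (e + s) (x + g) := by
  obtain ⟨u, hu, τ, hτ, hc, hus, huu, hsu, hgs, hgs', hlo, hhi, ha, hb⟩ := h
  have hss : star s = s := by rw [← huu, star_mul, hus]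
  have hse : s * e = 0 := by
    simpa [hss, he.isSelfAdjoint.star_eq] using congr(star $hes)
  have heS : e ∈ S := hvv ▸ mul_mem hv hv
  have hus' : u * s = u := by simpa [hus, hss] using congr(star $hsu)
  have hve : v * e = v := by simpa [hvs, he.isSelfAdjoint.star_eq] using congr(star $hev)
  have vu : v * u = 0 := by rw [← hve, ← hsu, mul_assoc, ← mul_assoc e, hes]; simp
  have uv : u * v = 0 := by rw [← hev, ← hus', mul_assoc, ← mul_assoc s, hse]; simp
  have xu : x * u = 0 := by rw [← hx', ← hsu, mul_assoc, ← mul_assoc e, hes]; simp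
  have ux : u * x = 0 := by rw [← hx, ← hus', mul_assoc, ← mul_assoc s, hse]; simp
  have vg : v * g = 0 := by rw [← hve, ← hgs, mul_assoc, ← mul_assoc e, hes]; simp
  have gv : g * v = 0 := by rw [← hev, ← hgs', mul_assoc, ← mul_assoc s, hse]; simp
  have eu : e * u = 0 := by rw [← hsu, ← mul_assoc, hes, zero_mul]
  have sv : s * v = 0 := by rw [← hev, ← mul_assoc, hse, zero_mul]
  have hxg : x + g + (v + u) * (x + g) * (v + u) = c • e + (g + u * g * u) := by
    rw [← hxv]
    simp only [mul_add, add_mul, ux, vg, mul_assoc, xu, gv, mul_zero, add_zero, zero_add]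
    abel
  have hee := he.isIdempotentElem.eq
  have conj : ∀ r : ℝ, e * (r • 1 : A) * e = r • e := fun r ↦ by simp [hee]
  have hete : e * τ * e = τ * e := by rw [← hc e heS, mul_assoc, hee]
  have h1 : lo • e ≤ τ * e := by
    rw [← conj, ← hete]; exact he.isSelfAdjoint.conjugate_le_conjugate hlo
  have h2 : τ * e ≤ hi • e := by
    rw [← conj, ← hete]; exact he.isSelfAdjoint.conjugate_le_conjugate hhi
  have he0 := he.nonneg
  have eg : e * g = 0 := by rw [← hvv, mul_assoc, vg, mul_zero]
  have sx : s * x = 0 := by rw [← huu, mul_assoc, ux, mul_zero]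
  have ge : g * e = 0 := by rw [← hvv, ← mul_assoc, gv, zero_mul]
  have xs : x * s = 0 := by rw [← huu, ← mul_assoc, xu, zero_mul]
  refine ⟨v + u, add_mem hv hu, τ, hτ, hc, ?_, ?_, ?_, ?_, ?_, hlo, hhi, ?_, ?_⟩
  · rw [star_add, hus, hvs]
  · simp [mul_add, add_mul, uv, vu, huu, hvv]
  · simp [mul_add, add_mul, hsu, hev, eu, sv]
  · simp [mul_add, add_mul, hgs, hx, eg, sx]
  · simp [mul_add, add_mul, hgs', hx', ge, xs]
  · rw [hxg, smul_add, mul_add, add_add_add_comm]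
    refine add_le_add ?_ ha
    calc a • e + τ * e ≤ a • e + hi • e := by gcongr
      _ = (a + hi) • e := (add_smul ..).symm
      _ ≤ c • e := by gcongr
  · rw [hxg, smul_add, mul_add, add_add_add_comm]
    refine add_le_add ?_ hb
    calc c • e ≤ (b + lo) • e := by gcongr
      _ = b • e + lo • e := add_smul ..
      _ ≤ b • e + τ * e := by gcongr

end ReflectionBound

namespace VonNeumannAlgebra
open ContinuousLinearMap

theorem real_smul_mem (W : VonNeumannAlgebra H) (c : ℝ) {x : H →L[ℂ] H} (hx : x ∈ W) :
    c • x ∈ W := by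
  have := W.toStarSubalgebra.smul_mem hx (c : ℂ)
  rwa [Complex.coe_smul] at this

theorem starProjection_topologicalClosure_mem (W : VonNeumannAlgebra H) (K : Submodule ℂ H)
    (hK : ∀ y ∈ W.commutant, ∀ ξ ∈ K, y ξ ∈ K) : K.topologicalClosure.starProjection ∈ W := by
  rw [IsStarProjection.mem_iff isStarProjection_starProjection]
  intro y hy
  rw [Submodule.range_starProjection]
  intro ξ hξ
  exact map_mem_closure y.continuous hξ fun x hx ↦ hK y hy x hx

/-- The left support projection of an element. -/
theorem exists_support (W : VonNeumannAlgebra H) {x : H →L[ℂ] H} (hx : x ∈ W) :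
    ∃ e ∈ W, IsStarProjection e ∧ e * x = x ∧ ∀ y : H →L[ℂ] H, y * x = 0 → y * e = 0 := by
  refine ⟨x.range.topologicalClosure.starProjection,
    W.starProjection_topologicalClosure_mem _ ?_, isStarProjection_starProjection, ?_, ?_⟩
  · rintro y hy _ ⟨ξ, rfl⟩
    exact ⟨y ξ, congr($(mem_commutant_iff.1 hy x hx) ξ)⟩
  · ext ξ
    exact Submodule.starProjection_eq_self_iff.2
      (Submodule.le_topologicalClosure _ (LinearMap.mem_range_self _ ξ))
  · intro y hy
    have : x.range.topologicalClosure ≤ y.ker := by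
      refine Submodule.topologicalClosure_minimal _ ?_ y.isClosed_ker
      rintro _ ⟨ξ, rfl⟩
      exact congr($hy ξ)
    ext ξ
    exact this (Submodule.starProjection_apply_mem _ ξ)

/-- Two projections `p`, `r` with `r W p = 0` are separated by a central projection. -/
theorem exists_central_separating (W : VonNeumannAlgebra H) {p r : H →L[ℂ] H} (hp : p ∈ W)
    (h : ∀ a ∈ W, r * a * p = 0) :
    ∃ z ∈ W, IsStarProjection z ∧ (∀ x ∈ W, z * x = x * z) ∧ z * p = p ∧ r * z = 0 := by
  set K : Submodule ℂ H := Submodule.span ℂ {ξ | ∃ a ∈ W, ∃ η, ξ = a (p η)} with hKdef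
  have hinv : ∀ y : H →L[ℂ] H, (∀ a ∈ W, ∃ b ∈ W, ∃ c, y * a * p = b * p * c) →
      ∀ ξ ∈ K, y ξ ∈ K := by
    intro y hy ξ hξ
    induction hξ using Submodule.span_induction with
    | mem ξ hξ =>
      obtain ⟨a, ha, η, rfl⟩ := hξ
      obtain ⟨b, hb, c, hbc⟩ := hy a ha
      exact Submodule.subset_span ⟨b, hb, c η, congr($hbc η)⟩
    | zero => simp
    | add ξ η _ _ h1 h2 => rw [map_add]; exact add_mem h1 h2
    | smul c ξ _ h1 => rw [map_smul]; exact K.smul_mem c h1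
  refine ⟨K.topologicalClosure.starProjection, W.starProjection_topologicalClosure_mem _ ?_,
    isStarProjection_starProjection, ?_, ?_, ?_⟩
  · intro y hy
    refine hinv y fun a ha ↦ ⟨a, ha, y, ?_⟩
    rw [← mem_commutant_iff.1 hy a ha, mul_assoc, mul_assoc, ← mem_commutant_iff.1 hy p hp]
  · have : K.topologicalClosure.starProjection ∈ W.commutant := by
      refine W.commutant.starProjection_topologicalClosure_mem _ ?_
      rw [commutant_commutant]
      exact fun y hy ↦ hinv y fun a ha ↦ ⟨y * a, mul_mem hy ha, 1, by simp⟩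
    exact fun x hx ↦ (mem_commutant_iff.1 this x hx).symm
  · ext ξ
    exact Submodule.starProjection_eq_self_iff.2
      (Submodule.le_topologicalClosure _ (Submodule.subset_span ⟨1, one_mem W, ξ, rfl⟩))
  · have : K.topologicalClosure ≤ r.ker := by
      refine Submodule.topologicalClosure_minimal _ (Submodule.span_le.2 ?_) r.isClosed_ker
      rintro _ ⟨a, ha, η, rfl⟩
      exact congr($(h a ha) η)
    ext ξ
    exact this (Submodule.starProjection_apply_mem _ ξ)

/-- For `P` the projection onto the graph of a maximal partial isometry between subprojections of
`p` and `r` (scaled by `√2`), nothing in `W` connects what is left of `p` with what is left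
of `r`. -/
theorem exists_maximal_graph_projection (W : VonNeumannAlgebra H) {p r : H →L[ℂ] H} (hp : p ∈ W)
    (hr : r ∈ W) (hpp : IsStarProjection p) (hrr : IsStarProjection r) (hpr : p * r = 0) :
    ∃ P ∈ W, IsStarProjection P ∧ P * p * P = P * r * P ∧ (p + r) * P = P ∧
      ∀ a ∈ W, (r - (2 : ℝ) • (r * P * r)) * a * (p - (2 : ℝ) • (p * P * p)) = 0 := by
  have hrp : r * p = 0 := by
    simpa [hpp.isSelfAdjoint.star_eq, hrr.isSelfAdjoint.star_eq] using congr(star $hpr)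
  let s : Set (Submodule ℂ H) := {K | (∀ y ∈ W.commutant, ∀ ξ ∈ K, y ξ ∈ K) ∧
    ∀ ξ ∈ K, p ξ + r ξ = ξ ∧ ‖p ξ‖ = ‖r ξ‖}
  obtain ⟨K, -, hKs, hKmax⟩ := zorn_le_nonempty₀ s (fun c hcs hc y hy ↦ by
    refine ⟨sSup c, ?_, fun z hz ↦ le_sSup hz⟩
    have hdir := hc.directedOn
    simp only [s, Set.mem_ofPred_eq, Submodule.mem_sSup_of_directed ⟨y, hy⟩ hdir]
    refine ⟨?_, ?_⟩
    · rintro y hy ξ ⟨K, hK, hξ⟩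
      exact ⟨K, hK, (hcs hK).1 y hy ξ hξ⟩
    · rintro ξ ⟨K, hK, hξ⟩
      exact (hcs hK).2 ξ hξ) ⊥ (by simp [s])
  set P := K.topologicalClosure.starProjection with hPdef
  have hPW : P ∈ W := W.starProjection_topologicalClosure_mem K hKs.1
  have hP : IsStarProjection P := isStarProjection_starProjection
  have hPK : ∀ ξ ∈ K, P ξ = ξ := fun ξ hξ ↦
    Submodule.starProjection_eq_self_iff.2 (Submodule.le_topologicalClosure _ hξ)
  have hcl : ∀ ξ ∈ K.topologicalClosure, p ξ + r ξ = ξ ∧ ‖p ξ‖ = ‖r ξ‖ := by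
    intro ξ hξ
    have hclosed : IsClosed {ξ | p ξ + r ξ = ξ ∧ ‖p ξ‖ = ‖r ξ‖} :=
      (isClosed_eq (by fun_prop) (by fun_prop)).inter (isClosed_eq (by fun_prop) (by fun_prop))
    exact closure_minimal hKs.2 hclosed hξ
  have hnorm : ∀ q : H →L[ℂ] H, IsStarProjection q → ∀ ξ,
      inner ℂ ((P * q * P) ξ) ξ = (‖q (P ξ)‖ ^ 2 : ℂ) := by
    intro q hq ξ
    have h1 : P * q * P = (q * P).adjoint * (q * P) := by
      rw [← star_eq_adjoint, star_mul, hP.isSelfAdjoint.star_eq, hq.isSelfAdjoint.star_eq,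
        mul_assoc, mul_assoc, ← mul_assoc q q, hq.isIdempotentElem.eq]
    rw [h1]
    change inner ℂ ((q * P).adjoint ((q * P) ξ)) ξ = _
    rw [adjoint_inner_left, inner_self_eq_norm_sq_to_K]
    simp
  have hPp : P * p * P = P * r * P := by
    rw [← sub_eq_zero]
    have := (inner_map_self_eq_zero ((P * p * P - P * r * P : H →L[ℂ] H) : H →ₗ[ℂ] H)).1 ?_
    · ext ξ; exact congr($this ξ)
    · intro ξ
      have : ‖p (P ξ)‖ = ‖r (P ξ)‖ := (hcl _ (Submodule.starProjection_apply_mem _ ξ)).2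
      rw [coe_coe, sub_apply, inner_sub_left, hnorm p hpp, hnorm r hrr, this, sub_self]
  have hprP : (p + r) * P = P := by
    ext ξ
    exact (hcl _ (Submodule.starProjection_apply_mem _ ξ)).1
  have hsum : P * p * P + P * r * P = P := by
    rw [← add_mul, ← mul_add, mul_assoc, hprP, hP.isIdempotentElem.eq]
  have h2p : (2 : ℝ) • (P * p * P) = P := by rw [two_smul]; nth_rw 2 [hPp]; exact hsum
  have h2r : (2 : ℝ) • (P * r * P) = P := by rw [← hPp, h2p]
  refine ⟨P, hPW, hP, hPp, hprP, fun a ha ↦ ?_⟩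
  set p₀ := p - (2 : ℝ) • (p * P * p) with hp₀
  set r₀ := r - (2 : ℝ) • (r * P * r) with hr₀
  have hp₀P : p₀ * P = 0 := by
    rw [hp₀, sub_mul, smul_mul_assoc, mul_assoc, mul_assoc p, ← mul_assoc P, ← mul_smul_comm, h2p,
      sub_self]
  have hr₀P : r₀ * P = 0 := by
    rw [hr₀, sub_mul, smul_mul_assoc, mul_assoc, mul_assoc r, ← mul_assoc P, ← mul_smul_comm, h2r,
      sub_self]
  have hpp₀ : p * p₀ = p₀ := by
    simp [hp₀, mul_sub, ← mul_assoc, hpp.isIdempotentElem.eq]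
  have hrr₀ : r * r₀ = r₀ := by
    simp [hr₀, mul_sub, ← mul_assoc, hrr.isIdempotentElem.eq]
  have hp₀p : p₀ * p = p₀ := by
    simp [hp₀, sub_mul, mul_assoc, hpp.isIdempotentElem.eq]
  have hp₀s : star p₀ = p₀ := by
    simp [hp₀, hpp.isSelfAdjoint.star_eq, hP.isSelfAdjoint.star_eq, mul_assoc]
  have hr₀s : star r₀ = r₀ := by
    simp [hr₀, hrr.isSelfAdjoint.star_eq, hP.isSelfAdjoint.star_eq, mul_assoc]
  have hp₀W : p₀ ∈ W := sub_mem hp (W.real_smul_mem 2 (mul_mem (mul_mem hp hPW) hp))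
  have hr₀W : r₀ ∈ W := sub_mem hr (W.real_smul_mem 2 (mul_mem (mul_mem hr hPW) hr))
  set x := r₀ * a * p₀ with hx
  have hxW : x ∈ W := mul_mem (mul_mem hr₀W ha) hp₀W
  have hrx : r * x = x := by rw [hx, ← mul_assoc, ← mul_assoc, hrr₀]
  have hpx : p * x = 0 := by rw [← hrx, ← mul_assoc, hpr, zero_mul]
  set y := CFC.abs x with hy
  have hys : star y = y := (CFC.abs_nonneg x).isSelfAdjoint
  have hyy : y * y = star x * x := CFC.abs_mul_abs x
  have hnxy : ∀ ξ, ‖y ξ‖ = ‖x ξ‖ := by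
    intro ξ
    have h1 := y.apply_norm_sq_eq_inner_adjoint_left ξ
    have h2 := x.apply_norm_sq_eq_inner_adjoint_left ξ
    rw [← star_eq_adjoint] at h1 h2
    have h3 : star y ∘L y = star x ∘L x := by rw [hys]; exact hyy
    rw [h3, ← h2] at h1
    exact (sq_eq_sq₀ (norm_nonneg _) (norm_nonneg _)).1 h1
  have hker : ∀ w : H →L[ℂ] H, x * w = 0 → y * w = 0 := by
    intro w hw
    ext ξ
    have : ‖y (w ξ)‖ = 0 := by rw [hnxy, show x (w ξ) = 0 from congr($hw ξ), norm_zero]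
    simpa using this
  have hyp : y * p = y := by
    have := hker (1 - p) (by rw [mul_sub, mul_one, hx, mul_assoc _ p₀, hp₀p, sub_self])
    rw [mul_sub, mul_one, sub_eq_zero] at this
    exact this.symm
  have hpy : p * y = y := by simpa [hys, hpp.isSelfAdjoint.star_eq] using congr(star $hyp)
  have hyPp : y * p₀ = y := by
    have h1 : x * (P * p) = 0 := by rw [← mul_assoc, hx, mul_assoc _ p₀, hp₀P]; simp
    have h2 : y * (P * p) = 0 := hker _ h1
    rw [hp₀, mul_sub, hyp, mul_smul_comm, ← mul_assoc, ← mul_assoc, hyp, mul_assoc, h2]; simp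
  have hp₀y : p₀ * y = y := by simpa [hys, hp₀s] using congr(star $hyPp)
  have hr₀x : r₀ * x = x := by
    have hP1 : P * r * P = (2 : ℝ)⁻¹ • P := by rw [← h2r, smul_smul]; norm_num [h2r]
    have : r₀ * r₀ = r₀ := by
      nth_rw 2 [hr₀]
      rw [mul_sub, mul_smul_comm, ← mul_assoc, ← mul_assoc]
      have : r₀ * r = r₀ := by simpa [hr₀s, hrr.isSelfAdjoint.star_eq] using congr(star $hrr₀)
      rw [this, hr₀P]; simp
    rw [hx, ← mul_assoc, ← mul_assoc, this]
  have hry : r * y = 0 := by rw [← hpy, ← mul_assoc, hrp, zero_mul]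
  have hyc : ∀ w ∈ W.commutant, w * y = y * w := by
    intro w hw
    have hc : Commute w x := (mem_commutant_iff.1 hw x hxW).symm
    have hc' : Commute x (star w) := mem_commutant_iff.1 (star_mem hw) x hxW
    exact (hc.symm.cfcAbs_right hc').eq
  have hnew : K ⊔ (y + x).range ∈ s := by
    refine ⟨?_, ?_⟩
    · intro w hw ξ hξ
      obtain ⟨κ, hκ, _, ⟨ζ, rfl⟩, rfl⟩ := Submodule.mem_sup.1 hξ
      rw [map_add]
      refine Submodule.add_mem_sup (hKs.1 w hw κ hκ) ⟨w ζ, ?_⟩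
      have : (y + x) * w = w * (y + x) := by
        rw [add_mul, mul_add, hyc w hw, mem_commutant_iff.1 hw x hxW]
      exact congr($this ζ)
    · intro ξ hξ
      obtain ⟨κ, hκ, _, ⟨ζ, rfl⟩, rfl⟩ := Submodule.mem_sup.1 hξ
      obtain ⟨h1, h2⟩ := hKs.2 κ hκ
      have e1 : p (κ + (y + x) ζ) = p κ + y ζ := by
        have : p * (y + x) = y := by rw [mul_add, hpy, hpx, add_zero]
        rw [map_add]; congr 1; exact congr($this ζ)
      have e2 : r (κ + (y + x) ζ) = r κ + x ζ := by
        have : r * (y + x) = x := by rw [mul_add, hry, hrx, zero_add]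
        rw [map_add]; congr 1; exact congr($this ζ)
      have orth : ∀ q q₀ w : H →L[ℂ] H, star q = q → star q₀ = q₀ → q * w = w → q₀ * w = w →
          q₀ * P = 0 → inner ℂ (q κ) (w ζ) = 0 := by
        intro q q₀ w hq hq₀ hw hw₀ hP
        have a1 : inner ℂ (q κ) (w ζ) = inner ℂ κ ((q * w) ζ) := by
          conv_lhs => rw [← hq, star_eq_adjoint, adjoint_inner_left]
          rfl
        have a2 : inner ℂ (q₀ κ) (w ζ) = inner ℂ κ ((q₀ * w) ζ) := by
          conv_lhs => rw [← hq₀, star_eq_adjoint, adjoint_inner_left]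
          rfl
        have a3 : q₀ κ = 0 := by rw [← hPK κ hκ]; exact congr($hP κ)
        rw [a1, hw, ← hw₀, ← a2, a3, inner_zero_left]
      have o1 := orth p p₀ y hpp.isSelfAdjoint hp₀s hpy hp₀y hp₀P
      have o2 := orth r r₀ x hrr.isSelfAdjoint hr₀s hrx hr₀x hr₀P
      simp only [coe_coe]
      rw [e1, e2]
      refine ⟨?_, ?_⟩
      · nth_rw 3 [← h1]
        rw [add_apply]; abel
      · have n1 := norm_add_sq_eq_norm_sq_add_norm_sq_of_inner_eq_zero _ _ o1
        have n2 := norm_add_sq_eq_norm_sq_add_norm_sq_of_inner_eq_zero _ _ o2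
        rw [h2, hnxy, ← n2] at n1
        nlinarith [norm_nonneg (p κ + y ζ), norm_nonneg (r κ + x ζ)]
  ext ξ
  have hmem : (y + x) ξ ∈ K := hKmax hnew le_sup_left (Submodule.mem_sup_right ⟨ξ, rfl⟩)
  have h1 : p₀ ((y + x) ξ) = 0 := by rw [← hPK _ hmem]; exact congr($hp₀P _)
  have h2 : p₀ * (y + x) = y := by
    rw [mul_add, hp₀y, ← hp₀p, mul_assoc, hpx]; simp
  have h3 : y ξ = 0 := by rw [← h1]; exact congr($h2.symm ξ)
  have h4 : ‖x ξ‖ = 0 := by rw [← hnxy, h3, norm_zero]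
  simpa using h4

end VonNeumannAlgebra

/-- The partial isometry whose graph projection is `P`, together with its adjoint, swaps its
initial and final projections. -/
theorem graph_projection_swap {A : Type*} [Ring A] [StarRing A] [Algebra ℝ A] [StarModule ℝ A]
    {p r P : A} (hpp : IsStarProjection p) (hrr : IsStarProjection r) (hpr : p * r = 0)
    (hP : IsStarProjection P) (hPp : P * p * P = P * r * P) (hprP : (p + r) * P = P) :
    let p' := (2 : ℝ) • (p * P * p)
    let r' := (2 : ℝ) • (r * P * r)
    let v := (2 : ℝ) • (r * P * p + p * P * r)
    IsStarProjection p' ∧ IsStarProjection r' ∧ p * p' = p' ∧ r * r' = r' ∧ star v = v ∧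
      v * v = p' + r' ∧ (p' + r') * v = v ∧ v * p' * v = r' ∧ v * r' * v = p' := by
  intro p' r' v
  have hps := hpp.isSelfAdjoint.star_eq
  have hrs := hrr.isSelfAdjoint.star_eq
  have hPs := hP.isSelfAdjoint.star_eq
  have hrp : r * p = 0 := by simpa [hps, hrs] using congr(star $hpr)
  have hsum : P * p * P + P * r * P = P := by
    rw [← add_mul, ← mul_add, mul_assoc, hprP, hP.isIdempotentElem.eq]
  have h2p : P * p * P = (2 : ℝ)⁻¹ • P := by
    rw [← hPp, ← two_smul ℝ] at hsum
    rw [← hsum, smul_smul, hsum]; norm_num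
  have h2r : P * r * P = (2 : ℝ)⁻¹ • P := by rw [← hPp, h2p]
  have ppx : ∀ x, p * (p * x) = p * x := fun x ↦ by rw [← mul_assoc, hpp.isIdempotentElem.eq]
  have rrx : ∀ x, r * (r * x) = r * x := fun x ↦ by rw [← mul_assoc, hrr.isIdempotentElem.eq]
  have prx : ∀ x, p * (r * x) = 0 := fun x ↦ by rw [← mul_assoc, hpr, zero_mul]
  have rpx : ∀ x, r * (p * x) = 0 := fun x ↦ by rw [← mul_assoc, hrp, zero_mul]
  have PpPx : ∀ x, P * (p * (P * x)) = (2 : ℝ)⁻¹ • (P * x) := fun x ↦ by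
    rw [← mul_assoc, ← mul_assoc, h2p, smul_mul_assoc]
  have PrPx : ∀ x, P * (r * (P * x)) = (2 : ℝ)⁻¹ • (P * x) := fun x ↦ by
    rw [← mul_assoc, ← mul_assoc, h2r, smul_mul_assoc]
  refine ⟨⟨?_, ?_⟩, ⟨?_, ?_⟩, ?_, ?_, ?_, ?_, ?_, ?_, ?_⟩
  · simp [p', IsIdempotentElem, mul_assoc, ppx, PpPx, smul_smul]
  · simp [p', IsSelfAdjoint, mul_assoc, hps, hPs]
  · simp [r', IsIdempotentElem, mul_assoc, rrx, PrPx, smul_smul]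
  · simp [r', IsSelfAdjoint, mul_assoc, hrs, hPs]
  · simp [p', mul_assoc, ppx]
  · simp [r', mul_assoc, rrx]
  · simp [v, mul_assoc, hps, hrs, hPs, add_comm]
  · simp [v, p', r', mul_assoc, mul_add, add_mul, ppx, rrx, rpx, prx, PpPx, PrPx, smul_smul,
      add_comm]
  · simp [v, p', r', mul_assoc, mul_add, add_mul, ppx, rrx, rpx, prx, PpPx, PrPx, smul_smul,
      add_comm]
  · simp [v, p', r', mul_assoc, mul_add, add_mul, ppx, rpx, prx, PpPx, smul_smul]
  · simp [v, p', r', mul_assoc, mul_add, add_mul, rrx, rpx, prx, PrPx, smul_smul]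

namespace VonNeumannAlgebra

open Finset

/-- Two orthogonal projections of `W` can be exchanged by a self-adjoint partial isometry up to
remainders lying under complementary central projections. -/
theorem exists_swap (W : VonNeumannAlgebra H) {p r : H →L[ℂ] H} (hp : p ∈ W)
    (hr : r ∈ W) (hpp : IsStarProjection p) (hrr : IsStarProjection r) (hpr : p * r = 0) :
    ∃ p' ∈ W, ∃ r' ∈ W, ∃ v ∈ W, ∃ z ∈ W, IsStarProjection p' ∧ IsStarProjection r' ∧
      p * p' = p' ∧ r * r' = r' ∧ star v = v ∧ v * v = p' + r' ∧ (p' + r') * v = v ∧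
      v * p' * v = r' ∧ v * r' * v = p' ∧ IsStarProjection z ∧ (∀ x ∈ W, z * x = x * z) ∧
      z * (p - p') = p - p' ∧ z * (r - r') = 0 := by
  obtain ⟨P, hPW, hP, hPp, hprP, hmax⟩ :=
    W.exists_maximal_graph_projection hp hr hpp hrr hpr
  have hp'W := W.real_smul_mem 2 (mul_mem (mul_mem hp hPW) hp)
  have hr'W := W.real_smul_mem 2 (mul_mem (mul_mem hr hPW) hr)
  obtain ⟨z, hzW, hz, hzc, hzp, hzr⟩ := W.exists_central_separating (sub_mem hp hp'W) hmax
  obtain ⟨h1, h2, h3, h4, h5, h6, h7, h8, h9⟩ := graph_projection_swap hpp hrr hpr hP hPp hprP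
  exact ⟨_, hp'W, _, hr'W, _,
    W.real_smul_mem 2 (add_mem (mul_mem (mul_mem hr hPW) hp) (mul_mem (mul_mem hp hPW) hr)), z, hzW,
    h1, h2, h3, h4, h5, h6, h7, h8, h9, hz, hzc, hzp, by rw [hzc _ (sub_mem hr hr'W), hzr]⟩

/-- Greedy pairing of the outermost values: an orthogonal combination of projections of `W` with
increasing coefficients in `[a, b]` satisfies a reflection bound. -/
theorem reflectionBound_sum (W : VonNeumannAlgebra H) {a b : ℝ} (d : ℕ) :
    ∀ (q : ℕ → H →L[ℂ] H) (t : ℕ → ℝ), Monotone t → a ≤ t 0 → t d ≤ b → (∀ i, q i ∈ W) →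
      (∀ i, IsStarProjection (q i)) → (∀ i j, i ≠ j → q i * q j = 0) →
      ReflectionBound W.toStarSubalgebra a b (t 0) (t d) (∑ i ∈ range (d + 1), q i)
        (∑ i ∈ range (d + 1), t i • q i) := by
  induction d with
  | zero =>
    intro q t ht ha hb hqW hq _
    simpa using ReflectionBound.of_scalar (hq 0) (hqW 0) ha hb
  | succ d ih =>
    intro q t ht ha hb hqW hq horth
    obtain ⟨p', hp'W, r', hr'W, v, hvW, z, hzW, hp', hr', hpp', hrr', hvs, hvv, hev, hvp, hvr, hz,
      hzc, hzp, hzr⟩ :=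
      W.exists_swap (hqW 0) (hqW (d + 1)) (hq 0) (hq (d + 1)) (horth _ _ (by simp))
    have hpp'' : p' * q 0 = p' := by
      simpa [hp'.isSelfAdjoint.star_eq, (hq 0).isSelfAdjoint.star_eq] using congr(star $hpp')
    have hrr'' : r' * q (d + 1) = r' := by
      simpa [hr'.isSelfAdjoint.star_eq, (hq (d + 1)).isSelfAdjoint.star_eq] using congr(star $hrr')
    have horth_mul : ∀ e f : H →L[ℂ] H, ∀ i j, e * q i = e → q j * f = f → i ≠ j → e * f = 0 := by
      intro e f i j he hf hij
      rw [← he, ← hf, mul_assoc, ← mul_assoc (q i), horth i j hij, zero_mul, mul_zero]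
    have hw : ∀ x ∈ W, (1 - z) * x = x * (1 - z) := fun x hx ↦ by
      rw [sub_mul, mul_sub, hzc x hx, one_mul, mul_one]
    have cut : ∀ (c : H →L[ℂ] H) (k : ℕ → H →L[ℂ] H) (σ : ℕ → ℕ), Function.Injective σ →
        c ∈ W → IsStarProjection c → (∀ x ∈ W, c * x = x * c) → (∀ i, k i ∈ W) →
        (∀ i, IsStarProjection (k i)) → (∀ i, q (σ i) * k i = k i) →
        (∀ i, c * k i ∈ W) ∧ (∀ i, IsStarProjection (c * k i)) ∧
          ∀ i j, i ≠ j → (c * k i) * (c * k j) = 0 := by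
      intro c k σ hσ hcW hc hcc hkW hk hqk
      refine ⟨fun i ↦ mul_mem hcW (hkW i), fun i ↦ hc.mul (hk i) (hcc _ (hkW i)), fun i j hij ↦ ?_⟩
      have h1 : k i * q (σ i) = k i := by
        simpa [(hk i).isSelfAdjoint.star_eq, (hq (σ i)).isSelfAdjoint.star_eq] using
          congr(star $(hqk i))
      rw [hcc _ (hkW j), mul_assoc, ← mul_assoc (k i),
        horth_mul _ _ _ _ h1 (hqk j) (hσ.ne hij), zero_mul, mul_zero]
    set k₁ : ℕ → H →L[ℂ] H := fun i ↦ if i = 0 then q 0 - p' else q i with hk₁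
    set k₂ : ℕ → H →L[ℂ] H := fun i ↦ if i = d then q (d + 1) - r' else q (i + 1) with hk₂
    obtain ⟨m₁, s₁, o₁⟩ := cut z k₁ id Function.injective_id hzW hz hzc
      (fun i ↦ by simp only [hk₁]; split_ifs; exacts [sub_mem (hqW 0) hp'W, hqW i])
      (fun i ↦ by
        simp only [hk₁]; split_ifs; exacts [hp'.sub_of_mul_eq_right (hq 0) hpp', hq i])
      (fun i ↦ by
        simp only [hk₁, id]; split_ifs with h
        · rw [h, mul_sub, hpp', (hq 0).isIdempotentElem.eq]
        · exact (hq i).isIdempotentElem.eq)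
    obtain ⟨m₂, s₂, o₂⟩ := cut (1 - z) k₂ (· + 1) (add_left_injective 1)
      (sub_mem (one_mem W) hzW) hz.one_sub hw
      (fun i ↦ by simp only [hk₂]; split_ifs; exacts [sub_mem (hqW _) hr'W, hqW _])
      (fun i ↦ by
        simp only [hk₂]; split_ifs; exacts [hr'.sub_of_mul_eq_right (hq _) hrr', hq _])
      (fun i ↦ by
        simp only [hk₂]; split_ifs with h
        · rw [h, mul_sub, hrr', (hq (d + 1)).isIdempotentElem.eq]
        · exact (hq _).isIdempotentElem.eq)
    have b₁ := (ih (fun i ↦ z * k₁ i) t ht ha ((ht d.le_succ).trans hb) m₁ s₁ o₁).mono le_rfl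
      (ht d.le_succ)
    have b₂ := (ih (fun i ↦ (1 - z) * k₂ i) (fun i ↦ t (i + 1))
      (fun i j hij ↦ ht (by omega)) (ha.trans (ht zero_le_one)) hb m₂ s₂ o₂).mono
      (ht zero_le_one) le_rfl
    simp only [← mul_smul_comm, ← mul_sum] at b₁ b₂
    set M := ∑ i ∈ range d, q (i + 1) with hM
    set N := ∑ i ∈ range d, t (i + 1) • q (i + 1) with hN
    have e₁ : ∑ i ∈ range (d + 1), k₁ i = q 0 - p' + M := by
      rw [sum_range_succ', add_comm]; simp [hk₁, hM]
    have e₂ : ∑ i ∈ range (d + 1), k₂ i = M + (q (d + 1) - r') := by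
      rw [sum_range_succ, hM]
      congr 1
      · exact sum_congr rfl fun i hi ↦ by simp [hk₂, (mem_range.1 hi).ne]
      · simp [hk₂]
    have e₃ : ∑ i ∈ range (d + 1), t i • k₁ i = t 0 • (q 0 - p') + N := by
      rw [sum_range_succ', add_comm]; simp [hk₁, hN]
    have e₄ : ∑ i ∈ range (d + 1), t (i + 1) • k₂ i = N + t (d + 1) • (q (d + 1) - r') := by
      rw [sum_range_succ, hN]
      congr 1
      · exact sum_congr rfl fun i hi ↦ by simp [hk₂, (mem_range.1 hi).ne]
      · simp [hk₂]
    rw [e₁, e₃] at b₁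
    rw [e₂, e₄] at b₂
    have hNW : N ∈ W := sum_mem fun i _ ↦ W.real_smul_mem _ (hqW _)
    have hzz := hz.isIdempotentElem.eq
    have hzw : z * (1 - z) = 0 := hz.mul_one_sub_self
    have b₃ := b₁.add_of_central b₂ hz hzW hzc
      (mul_mem hzW (add_mem (W.real_smul_mem _ (sub_mem (hqW _) hp'W)) hNW))
      (mul_mem (sub_mem (one_mem W) hzW) (add_mem hNW (W.real_smul_mem _ (sub_mem (hqW _) hr'W))))
      (by rw [← mul_assoc, hzz]) (by rw [← mul_assoc, hzw, zero_mul])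
      (by rw [← mul_assoc, hzz]) (by rw [← mul_assoc, hzw, zero_mul])
    have f₁ : z * (q 0 - p' + M) + (1 - z) * (M + (q (d + 1) - r')) =
        q 0 - p' + M + (q (d + 1) - r') := by
      rw [sub_mul, mul_add, mul_add z M, hzp, hzr]; simp; abel
    have f₂ : z * (t 0 • (q 0 - p') + N) + (1 - z) * (N + t (d + 1) • (q (d + 1) - r')) =
        t 0 • (q 0 - p') + N + t (d + 1) • (q (d + 1) - r') := by
      rw [sub_mul, mul_add, mul_add z N, mul_smul_comm, mul_smul_comm, hzp, hzr]; simp; abel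
    rw [f₁, f₂] at b₃
    have hp'r' : p' * r' = 0 := horth_mul _ _ 0 (d + 1) hpp'' hrr' (by simp)
    have hr'p' : r' * p' = 0 := horth_mul _ _ (d + 1) 0 hrr'' hpp' (by simp)
    have hpM : p' * M = 0 := by
      rw [hM, mul_sum]
      exact sum_eq_zero fun i _ ↦ horth_mul _ _ 0 (i + 1) hpp'' (hq _).isIdempotentElem (by simp)
    have hrM : r' * M = 0 := by
      rw [hM, mul_sum]
      exact sum_eq_zero fun i hi ↦ horth_mul _ _ (d + 1) (i + 1) hrr'' (hq _).isIdempotentElem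
        (by have := mem_range.1 hi; omega)
    have hpq : p' * q (d + 1) = 0 :=
      horth_mul _ _ 0 (d + 1) hpp'' (hq _).isIdempotentElem (by simp)
    have hrq : r' * q 0 = 0 := horth_mul _ _ (d + 1) 0 hrr'' (hq _).isIdempotentElem (by simp)
    have hp2 := hp'.isIdempotentElem.eq
    have hr2 := hr'.isIdempotentElem.eq
    have b₄ := b₃.add_of_swap (x := t 0 • p' + t (d + 1) • r') (c := t 0 + t (d + 1)) hvW hvs hvv
      hev ?_ (hp'.add hr' hp'r') ?_ ?_ ?_ (by linarith) (by linarith)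
    · convert b₄ using 1
      · rw [sum_range_succ, sum_range_succ']; abel
      · rw [sum_range_succ, sum_range_succ', smul_sub, smul_sub]; abel
    · simp [mul_add, add_mul, mul_sub, hpp'', hrr'', hp2, hr2, hpM, hrM, hpq, hrq, hp'r', hr'p']
    · simp [mul_add, add_mul, hp2, hr2, hp'r', hr'p']
    · simp [mul_add, add_mul, hp2, hr2, hp'r', hr'p']
    · simp only [mul_add, add_mul, mul_smul_comm, smul_mul_assoc, hvp, hvr]
      module

end VonNeumannAlgebra

section Layers

variable {A : Type*} [CStarAlgebra A] [PartialOrder A] [StarOrderedRing A]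

theorem norm_le_of_neg_smul_one_le_of_le {x : A} {r : ℝ} (hr : 0 ≤ r)
    (h₁ : -(r • 1) ≤ x) (h₂ : x ≤ r • 1) : ‖x‖ ≤ r := by
  have hx : IsSelfAdjoint x := by
    have h := (IsSelfAdjoint.of_nonneg (sub_nonneg.2 h₁)).add
      ((IsSelfAdjoint.all r).smul (IsSelfAdjoint.one A)).neg
    rwa [sub_add_cancel] at h
  rw [← Algebra.algebraMap_eq_smul_one] at h₁ h₂
  rw [← map_neg] at h₁
  rw [← cfc_id ℝ x]
  refine norm_cfc_le hr fun y hy ↦ abs_le.2 ⟨?_, ?_⟩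
  · exact (algebraMap_le_iff_le_spectrum hx).1 h₁ y hy
  · exact (le_algebraMap_iff_spectrum_le hx).1 h₂ y hy

/-- The increment of the ramp `s ↦ max (s - t) 0` over a step of length `δ` is squeezed between
multiples of the support projections of the ramps. -/
theorem smul_support_le_ramp_sub_le {g e e' : A} (hg : IsSelfAdjoint g) {t δ : ℝ} (hδ : 0 < δ)
    (he : IsStarProjection e) (he' : IsStarProjection e')
    (h : e * cfc (fun s ↦ max (s - t) 0) g = cfc (fun s ↦ max (s - t) 0) g)
    (h' : ∀ y : A, y * cfc (fun s ↦ max (s - (t + δ)) 0) g = 0 → y * e' = 0) :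
    δ • e' ≤ cfc (fun s ↦ max (s - t) 0) g - cfc (fun s ↦ max (s - (t + δ)) 0) g ∧
      cfc (fun s ↦ max (s - t) 0) g - cfc (fun s ↦ max (s - (t + δ)) 0) g ≤ δ • e := by
  set R := cfc (fun s ↦ max (s - t) 0) g with hR
  set R' := cfc (fun s ↦ max (s - (t + δ)) 0) g with hR'
  set F := R - R' with hF
  have hFc : F = cfc (fun s ↦ max (s - t) 0 - max (s - (t + δ)) 0) g := (cfc_sub ..).symm
  have hF0 : 0 ≤ F := by
    rw [hFc]
    exact cfc_nonneg fun s _ ↦ sub_nonneg.2 (max_le_max (by linarith) le_rfl)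
  have hFδ : F ≤ δ • 1 := by
    rw [hFc, ← Algebra.algebraMap_eq_smul_one]
    refine cfc_le_algebraMap _ _ _ fun s _ ↦ ?_
    rcases max_cases (s - t) 0 with ⟨h, _⟩ | ⟨h, _⟩ <;>
      rcases max_cases (s - (t + δ)) 0 with ⟨h', _⟩ | ⟨h', _⟩ <;> rw [h, h'] <;> linarith
  have hFs : star F = F := hF0.isSelfAdjoint
  have hRs : star R = R := cfc_predicate (p := IsSelfAdjoint) _ g
  constructor
  · have h1 : (F - δ • 1) * R' = 0 := by
      rw [hFc, ← Algebra.algebraMap_eq_smul_one, ← cfc_const δ g, ← cfc_sub .., hR', ← cfc_mul ..,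
        ← cfc_zero ℝ g]
      refine cfc_congr fun s _ ↦ ?_
      rcases max_cases (s - t) 0 with ⟨h, _⟩ | ⟨h, _⟩ <;>
      rcases max_cases (s - (t + δ)) 0 with ⟨h', _⟩ | ⟨h', _⟩ <;>
        simp [h, h']; try linarith
    have h2 : F * e' = δ • e' := by
      simpa [sub_mul, sub_eq_zero] using h' _ h1
    have h3 : e' * F = δ • e' := by simpa [hFs, he'.isSelfAdjoint.star_eq] using congr(star $h2)
    have h4 := he'.one_sub.isSelfAdjoint.conjugate_nonneg hF0
    have h5 : (1 - e') * F * (1 - e') = F - δ • e' := by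
      simp [sub_mul, mul_sub, h2, h3, he'.isIdempotentElem.eq]
    rw [h5] at h4
    exact sub_nonneg.1 h4
  · have h1 : R * e = R := by simpa [hRs, he.isSelfAdjoint.star_eq] using congr(star $h)
    have hpos : ∀ s, max (s - t) δ ≠ 0 := fun s ↦ (hδ.trans_le (le_max_right _ _)).ne'
    have h2 : F = cfc (fun s ↦ δ / max (s - t) δ) g * R := by
      rw [hFc, hR, ← cfc_mul (fun s ↦ δ / max (s - t) δ) _ g
        (by exact (continuous_const.div (by fun_prop) hpos).continuousOn)]
      refine cfc_congr fun s _ ↦ ?_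
      have := hpos s
      rw [div_mul_eq_mul_div, eq_div_iff this]
      rcases max_cases (s - t) 0 with ⟨h, _⟩ | ⟨h, _⟩ <;>
      rcases max_cases (s - (t + δ)) 0 with ⟨h', _⟩ | ⟨h', _⟩ <;>
      rcases max_cases (s - t) δ with ⟨h'', _⟩ | ⟨h'', _⟩ <;>
        rw [h, h', h''] <;> first | ring1 | (exfalso; linarith)
    have h3 : F * e = F := by rw [h2, mul_assoc, h1]
    have h4 : e * F = F := by simpa [hFs, he.isSelfAdjoint.star_eq] using congr(star $h3)
    have h5 := he.isSelfAdjoint.conjugate_le_conjugate hFδ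
    rwa [h4, h3, mul_smul_comm, mul_one, smul_mul_assoc, he.isIdempotentElem.eq] at h5

end Layers

namespace VonNeumannAlgebra

open Finset

theorem cfc_mem (W : VonNeumannAlgebra H) {g : H →L[ℂ] H} (hg : g ∈ W) (f : ℝ → ℝ) :
    cfc f g ∈ W := by
  rw [← commutant_commutant W, mem_commutant_iff]
  intro y hy
  exact (Commute.cfc_real (mem_commutant_iff.1 hy g hg) f).eq.symm

/-- Uniform approximation of a self-adjoint element by a combination of a decreasing chain of
projections. -/
theorem exists_chain_approx (W : VonNeumannAlgebra H) {g : H →L[ℂ] H} (hg : g ∈ W)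
    (hsa : IsSelfAdjoint g) {a δ : ℝ} (hδ : 0 < δ) (n : ℕ) (ha : a • 1 ≤ g)
    (hb : g ≤ (a + n * δ) • 1) :
    ∃ E : ℕ → H →L[ℂ] H, E 0 = 1 ∧ E (n + 1) = 0 ∧ (∀ k, E k ∈ W) ∧
      (∀ k, IsStarProjection (E k)) ∧ Antitone E ∧
      a • 1 + δ • ∑ k ∈ range n, E (k + 1) ≤ g ∧
      g ≤ a • 1 + δ • ∑ k ∈ range n, E (k + 1) + δ • 1 := by
  set R : ℕ → H →L[ℂ] H := fun k ↦ cfc (fun s ↦ max (s - (a + k * δ)) 0) g with hR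
  choose e heW he heR hsupp using fun k : ℕ ↦ W.exists_support (W.cfc_mem hg
    (fun s ↦ max (s - (a + k * δ)) 0))
  have hstep : ∀ k, δ • e (k + 1) ≤ R k - R (k + 1) ∧ R k - R (k + 1) ≤ δ • e k := by
    intro k
    have hk : a + ((k + 1 : ℕ) : ℝ) * δ = a + k * δ + δ := by push_cast; ring
    have h' := hsupp (k + 1)
    simp only [hk] at h'
    simp only [hR, hk]
    exact smul_support_le_ramp_sub_le hsa hδ (he k) (he (k + 1)) (heR k) h'
  have hanti : ∀ k, e (k + 1) ≤ e k := fun k ↦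
    le_of_smul_le_smul_left ((hstep k).1.trans (hstep k).2) hδ
  have hR0 : R 0 = g - a • 1 := by
    have hspec : ∀ s ∈ spectrum ℝ g, a ≤ s :=
      (algebraMap_le_iff_le_spectrum hsa).1 (by rwa [Algebra.algebraMap_eq_smul_one])
    have : cfc (fun s : ℝ ↦ s - a) g = g - a • 1 := by
      rw [cfc_sub (fun s ↦ s) (fun _ ↦ a) g, cfc_id' ℝ g, cfc_const a g,
        Algebra.algebraMap_eq_smul_one]
    rw [← this]
    refine cfc_congr fun s hs ↦ ?_
    simp [hspec s hs]
  have hRn : R n = 0 := by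
    have hspec : ∀ s ∈ spectrum ℝ g, s ≤ a + n * δ :=
      (le_algebraMap_iff_spectrum_le hsa).1 (by rwa [Algebra.algebraMap_eq_smul_one])
    rw [← cfc_zero ℝ g]
    refine cfc_congr fun s hs ↦ ?_
    simpa using hspec s hs
  have hsum : ∑ k ∈ range n, (R k - R (k + 1)) = g - a • 1 := by
    rw [sum_range_sub', hR0, hRn, sub_zero]
  set E : ℕ → H →L[ℂ] H := fun k ↦ if k = 0 then 1 else if k ≤ n then e k else 0 with hE
  have hEe : ∑ k ∈ range n, E (k + 1) = ∑ k ∈ range n, e (k + 1) :=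
    sum_congr rfl fun k hk ↦ by simp [hE, Nat.succ_le_of_lt (mem_range.1 hk)]
  have hEp : ∀ k, IsStarProjection (E k) := fun k ↦ by
    simp only [hE]; split_ifs; exacts [.one _, he k, .zero _]
  refine ⟨E, by simp [hE], by simp [hE], fun k ↦ ?_, hEp, antitone_nat_of_succ_le fun k ↦ ?_,
    ?_, ?_⟩
  · simp only [hE]; split_ifs; exacts [one_mem W, heW k, zero_mem W]
  · rcases k with _ | k
    · exact (hEp 1).le_one
    · simp only [hE, Nat.add_eq_zero_iff, one_ne_zero, and_false, if_false]
      split_ifs with h1 h2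
      · exact hanti _
      · omega
      · exact (he _).nonneg
      · exact le_rfl
  · rw [hEe, add_comm, ← le_sub_iff_add_le, ← hsum, smul_sum]
    exact sum_le_sum fun k _ ↦ (hstep k).1
  · have h1 : g - a • 1 ≤ δ • ∑ k ∈ range n, e k := by
      rw [← hsum, smul_sum]
      exact sum_le_sum fun k _ ↦ (hstep k).2
    have h2 : ∑ k ∈ range n, e k ≤ ∑ k ∈ range n, e (k + 1) + 1 := by
      have h3 : ∑ k ∈ range n, (e k - e (k + 1)) = e 0 - e n := sum_range_sub' _ _
      rw [sum_sub_distrib] at h3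
      rw [← sub_le_iff_le_add', h3]
      exact (sub_le_self _ (he n).nonneg).trans (he 0).le_one
    rw [hEe, add_assoc, ← smul_add, ← sub_le_iff_le_add']
    exact h1.trans (smul_le_smul_of_nonneg_left h2 hδ.le)

/-- Uniform approximation of a self-adjoint element by a step function with equidistant values. -/
theorem exists_step_approx (W : VonNeumannAlgebra H) {g : H →L[ℂ] H} (hg : g ∈ W)
    (hsa : IsSelfAdjoint g) {a δ : ℝ} (hδ : 0 < δ) (n : ℕ) (ha : a • 1 ≤ g)
    (hb : g ≤ (a + n * δ) • 1) :
    ∃ q : ℕ → H →L[ℂ] H, (∀ k, q k ∈ W) ∧ (∀ k, IsStarProjection (q k)) ∧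
      (∀ i j, i ≠ j → q i * q j = 0) ∧ ∑ k ∈ range (n + 1), q k = 1 ∧
      ∑ k ∈ range (n + 1), (a + k * δ) • q k ≤ g ∧
      g ≤ ∑ k ∈ range (n + 1), (a + k * δ) • q k + δ • 1 := by
  obtain ⟨E, hE0, hEn, hEW, hE, hanti, h₁, h₂⟩ := W.exists_chain_approx hg hsa hδ n ha hb
  have hmul : ∀ i j, i ≤ j → E i * E j = E j := fun i j hij ↦
    ((hE j).le_iff_mul_eq_right (hE i)).1 (hanti hij)
  have hmul' : ∀ i j, i ≤ j → E j * E i = E j := fun i j hij ↦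
    ((hE j).le_iff_mul_eq_left (hE i)).1 (hanti hij)
  have habel : ∀ m : ℕ, ∑ k ∈ range (m + 1), (a + k * δ) • (E k - E (k + 1)) =
      a • 1 + δ • ∑ k ∈ range m, E (k + 1) - (a + m * δ) • E (m + 1) := by
    intro m
    induction m with
    | zero => simp [hE0, smul_sub]
    | succ m ih =>
      rw [sum_range_succ, ih, sum_range_succ _ m]
      push_cast
      module
  rw [← sub_zero (a • 1 + _), ← smul_zero (a + n * δ), ← hEn, ← habel] at h₁ h₂
  refine ⟨fun k ↦ E k - E (k + 1), fun k ↦ sub_mem (hEW k) (hEW _), fun k ↦ ?_, fun i j hij ↦ ?_,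
    ?_, h₁, h₂⟩
  · exact (hE _).sub_of_mul_eq_right (hE k) (hmul k (k + 1) k.le_succ)
  · rcases hij.lt_or_gt with h | h
    · simp [sub_mul, mul_sub, hmul i j h.le, hmul i (j + 1) (by omega), hmul (i + 1) j h,
        hmul (i + 1) (j + 1) (by omega)]
    · simp [sub_mul, mul_sub, hmul' j i h.le, hmul' j (i + 1) (by omega), hmul' (j + 1) i h,
        hmul' (j + 1) (i + 1) (by omega)]
  · rw [sum_range_sub', hE0, hEn, sub_zero]

end VonNeumannAlgebra

/-- **Theorem 4.2 (first part).**  Every von Neumann algebra `W` has the uniform Dixmier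
property with constants `(2, γ)` for every `γ ∈ (1/2, 1)`: for each self-adjoint `g ∈ W`
there are a central element `z` of `W` and unitaries `u₁, u₂ ∈ W` with
`‖(1/2)(u₁ g u₁* + u₂ g u₂*) − z‖ ≤ γ ‖g‖`. -/
theorem vonNeumann_uniformDixmier (W : VonNeumannAlgebra H)
    (γ : ℝ) (hγ : γ ∈ Set.Ioo (1 / 2 : ℝ) 1)
    (g : H →L[ℂ] H) (hg : g ∈ W) (hsa : IsSelfAdjoint g) :
    ∃ z u₁ u₂ : H →L[ℂ] H,
      z ∈ W ∧ (∀ x ∈ W, z * x = x * z) ∧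
      u₁ ∈ W ∧ u₁ * star u₁ = 1 ∧ star u₁ * u₁ = 1 ∧
      u₂ ∈ W ∧ u₂ * star u₂ = 1 ∧ star u₂ * u₂ = 1 ∧
      ‖(2 : ℝ)⁻¹ • (u₁ * g * star u₁ + u₂ * g * star u₂) - z‖ ≤ γ * ‖g‖ := by
  rcases eq_or_ne g 0 with rfl | hg0
  · exact ⟨0, 1, 1, zero_mem W, by simp, one_mem W, by simp, by simp, one_mem W, by simp, by simp,
      by simp⟩
  have hM : 0 < ‖g‖ := norm_pos_iff.2 hg0
  set M := ‖g‖
  obtain ⟨n, hn⟩ := exists_nat_gt (2 * M / ((γ - 1 / 2) * M))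
  have hγM : 0 < (γ - 1 / 2) * M := mul_pos (sub_pos.2 hγ.1) hM
  have hn0 : (0 : ℝ) < n := lt_of_le_of_lt (by positivity) hn
  obtain ⟨δ, hδ, hnδ, hδγ⟩ : ∃ δ : ℝ, 0 < δ ∧ n * δ = 2 * M ∧ δ ≤ (γ - 1 / 2) * M := by
    refine ⟨2 * M / n, by positivity, by field_simp, ?_⟩
    rw [div_le_iff₀' hn0]
    exact ((div_lt_iff₀ hγM).1 hn).le
  have hlow : -M • (1 : H →L[ℂ] H) ≤ g := by
    simpa [Algebra.algebraMap_eq_smul_one] using hsa.neg_algebraMap_norm_le_self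
  have hupp : g ≤ (-M + n * δ) • (1 : H →L[ℂ] H) := by
    rw [hnδ, show -M + 2 * M = M by ring, ← Algebra.algebraMap_eq_smul_one]
    exact hsa.le_algebraMap_norm_self
  obtain ⟨q, hqW, hq, horth, hq1, hqlow, hqupp⟩ := W.exists_step_approx hg hsa hδ n hlow hupp
  obtain ⟨u, huW, τ, hτW, hτc, hus, huu, -, -, -, -, -, hlo, hhi⟩ :=
    W.reflectionBound_sum (a := -M) (b := M) n q (fun k ↦ -M + k * δ)
      (fun i j hij ↦ by dsimp only; gcongr) (by simp) (by rw [hnδ]; linarith) hqW hq horth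
  rw [hq1] at huu hlo hhi
  rw [mul_one] at hlo hhi
  set G := ∑ k ∈ Finset.range (n + 1), (-M + k * δ) • q k
  have hconj₁ : u * G * u ≤ u * g * u := IsSelfAdjoint.conjugate_le_conjugate hqlow hus
  have hconj₂ : u * g * u ≤ u * G * u + δ • 1 := by
    have := IsSelfAdjoint.conjugate_le_conjugate hqupp hus
    rwa [mul_add, add_mul, mul_smul_comm, smul_mul_assoc, mul_one, huu] at this
  have hX₁ : -(M • 1) ≤ g + u * g * u - τ := by
    rw [le_sub_iff_add_le, ← neg_smul]
    exact hlo.trans (add_le_add hqlow hconj₁)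
  have hX₂ : g + u * g * u - τ ≤ (2 * (γ * M)) • 1 := by
    have h : (M + 2 * δ) • (1 : H →L[ℂ] H) ≤ (2 * (γ * M)) • 1 :=
      smul_le_smul_of_nonneg_right (by linarith) zero_le_one
    refine le_trans ?_ h
    rw [sub_le_iff_le_add]
    calc g + u * g * u ≤ (G + δ • 1) + (u * G * u + δ • 1) := add_le_add hqupp hconj₂
      _ = (G + u * G * u) + (2 * δ) • 1 := by module
      _ ≤ (M • 1 + τ) + (2 * δ) • 1 := by gcongr
      _ = (M + 2 * δ) • 1 + τ := by module
  have hX₃ : -((2 * (γ * M)) • 1) ≤ g + u * g * u - τ := by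
    refine le_trans (neg_le_neg (smul_le_smul_of_nonneg_right ?_ zero_le_one)) hX₁
    nlinarith [hγ.1]
  have hnorm := norm_le_of_neg_smul_one_le_of_le (mul_nonneg zero_le_two
    (mul_nonneg (by linarith [hγ.1]) hM.le)) hX₃ hX₂
  refine ⟨(2 : ℝ)⁻¹ • τ, 1, u, ?_, fun x hx ↦ ?_, one_mem W, by simp, by simp, huW,
    by rw [hus, huu], by rw [hus, huu], ?_⟩
  · exact W.real_smul_mem _ hτW
  · rw [smul_mul_assoc, hτc x hx, mul_smul_comm]
  · rw [one_mul, star_one, mul_one, hus, ← smul_sub, norm_smul]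
    norm_num
    linarith

end
end

section
/- Let A be a simple, unital, non-elementary (i.e., infinite-dimensional) C*-algebra, let h ∈ A be self-adjoint, and let ε > 0. Then: (i) there exists a unitary u ∈ A such that the spectrum of (1/3)h + (2/3)u h u* has gaps of size at most ω(h)/3 + ε; (ii) if the spectrum of h has gaps of size at most δ > 0, then there exist a self-adjoint element h̃ ∈ A and an element x ∈ A such that ‖x‖² = δ/2, x² = 0, ‖h − (h̃ + [x*, x])‖ < ε, and the spectrum of h̃ equals the interval [l(h) − δ/2, r(h) + δ/2]. -/
noncomputable section

variable {A : Type*} [CStarAlgebra A]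

/-- A closed two-sided ideal of a C*-algebra, regarded as a `ℂ`-submodule. -/
def IsClosedTwoSidedIdeal (I : Submodule ℂ A) : Prop :=
  IsClosed (I : Set A) ∧ ∀ a b : A, b ∈ I → a * b ∈ I ∧ b * a ∈ I

/-- A C*-algebra is simple if it has no nonzero proper closed two-sided ideals. -/
def IsSimpleCStarAlgebra (A : Type*) [CStarAlgebra A] : Prop :=
  ∀ I : Submodule ℂ A, IsClosedTwoSidedIdeal I → I = ⊥ ∨ I = ⊤

/-- The spectrum of a self-adjoint element `h` has gaps of size at most `δ` if every closed
subinterval of `[l(h), r(h)]` of length `δ` intersects the spectrum of `h`.  Here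
`l(h) = inf sp(h)` and `r(h) = sup sp(h)`. -/
def SpectrumHasGapsAtMost (h : A) (δ : ℝ) : Prop :=
  ∀ s t : ℝ, sInf (spectrum ℝ h) ≤ s → t ≤ sSup (spectrum ℝ h) → t - s = δ →
    ∃ x ∈ Set.Icc s t, x ∈ spectrum ℝ h

/-- `ω(h) = r(h) − l(h)`, the length of the smallest interval containing the spectrum. -/
def omegaSpec (h : A) : ℝ := sSup (spectrum ℝ h) - sInf (spectrum ℝ h)
/-! ### Simplicity -/

section Simple

open Submodule

theorem IsSimpleCStarAlgebra.exists_isUnit_mem_span (hA : IsSimpleCStarAlgebra A)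
    {c : A} (hc : c ≠ 0) :
    ∃ j ∈ span ℂ {z : A | ∃ a b : A, z = a * c * b}, IsUnit j := by
  set J := span ℂ {z : A | ∃ a b : A, z = a * c * b} with hJ
  have hmul : ∀ a b : A, b ∈ J → a * b ∈ J ∧ b * a ∈ J := by
    intro a b hb
    constructor
    · induction hb using span_induction with
      | mem x hx =>
        obtain ⟨a', b', rfl⟩ := hx
        exact subset_span ⟨a * a', b', by simp only [mul_assoc]⟩
      | zero => simp
      | add x y _ _ hx hy => rw [mul_add]; exact J.add_mem hx hy
      | smul r x _ hx => rw [mul_smul_comm]; exact J.smul_mem r hx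
    · induction hb using span_induction with
      | mem x hx =>
        obtain ⟨a', b', rfl⟩ := hx
        exact subset_span ⟨a', b' * a, by simp only [mul_assoc]⟩
      | zero => simp
      | add x y _ _ hx hy => rw [add_mul]; exact J.add_mem hx hy
      | smul r x _ hx => rw [smul_mul_assoc]; exact J.smul_mem r hx
  have hcJ : c ∈ J := subset_span ⟨1, 1, by simp⟩
  have hid : IsClosedTwoSidedIdeal J.topologicalClosure := by
    refine ⟨J.isClosed_topologicalClosure, fun a b hb => ⟨?_, ?_⟩⟩
    · exact map_mem_closure (f := fun x => a * x) (by fun_prop) hb fun x hx => (hmul a x hx).1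
    · exact map_mem_closure (f := fun x => x * a) (by fun_prop) hb fun x hx => (hmul a x hx).2
  have htop : J.topologicalClosure = ⊤ := by
    refine (hA _ hid).resolve_left fun hbot => hc ?_
    have := J.le_topologicalClosure hcJ
    rwa [hbot, mem_bot] at this
  have h1 : (1 : A) ∈ closure (J : Set A) := by
    have : (1 : A) ∈ J.topologicalClosure := by rw [htop]; trivial
    exact this
  obtain ⟨j, hjJ, hj⟩ := Metric.mem_closure_iff.1 h1 1 one_pos
  refine ⟨j, hjJ, ?_⟩
  have := isUnit_one_sub_of_norm_lt_one (x := (1 : A) - j) (by rwa [← dist_eq_norm])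
  simpa using this

theorem IsSimpleCStarAlgebra.exists_mul_mul_ne_zero (hA : IsSimpleCStarAlgebra A)
    {f g : A} (hf : f ≠ 0) (hg : g ≠ 0) : ∃ z : A, g * z * f ≠ 0 := by
  by_contra! H
  obtain ⟨j, hj, hu⟩ := hA.exists_isUnit_mem_span hf
  have hgj : g * j = 0 := by
    clear hu
    induction hj using span_induction with
    | mem x hx =>
      obtain ⟨a, b, rfl⟩ := hx
      rw [← mul_assoc, ← mul_assoc, H, zero_mul]
    | zero => simp
    | add x y _ _ hx hy => rw [mul_add, hx, hy, add_zero]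
    | smul r x _ hx => rw [mul_smul_comm, hx, smul_zero]
  exact hg (hu.mul_left_eq_zero.1 hgj)

theorem IsSimpleCStarAlgebra.exists_mul_mul_not_smul (hA : IsSimpleCStarAlgebra A)
    (hinf : ¬ FiniteDimensional ℂ A) {c : A} (hc : c ≠ 0) :
    ∃ z : A, ∀ r : ℂ, c * z * c ≠ r • c := by
  by_contra! H
  apply hinf
  obtain ⟨j, hj, hu⟩ := hA.exists_isUnit_mem_span hc
  have key : ∃ V : Submodule ℂ A, FiniteDimensional ℂ V ∧ ∀ z, j * z * j ∈ V := by
    suffices ∀ x ∈ span ℂ {z : A | ∃ a b : A, z = a * c * b},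
        ∀ y ∈ span ℂ {z : A | ∃ a b : A, z = a * c * b},
        ∃ V : Submodule ℂ A, FiniteDimensional ℂ V ∧ ∀ z, x * z * y ∈ V from this j hj j hj
    intro x hx y hy
    induction hx, hy using span_induction₂ with
    | mem_mem x y hx hy =>
      obtain ⟨a, b, rfl⟩ := hx
      obtain ⟨a', b', rfl⟩ := hy
      refine ⟨span ℂ {a * c * b'}, inferInstance, fun z => ?_⟩
      obtain ⟨r, hr⟩ := H (b * z * a')
      have : a * c * b * z * (a' * c * b') = r • (a * c * b') := by
        calc _ = a * (c * (b * z * a') * c) * b' := by simp only [mul_assoc]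
          _ = _ := by rw [hr, mul_smul_comm, smul_mul_assoc]
      rw [this]
      exact smul_mem _ _ (mem_span_singleton_self _)
    | zero_left y _ => exact ⟨⊥, inferInstance, by simp⟩
    | zero_right x _ => exact ⟨⊥, inferInstance, by simp⟩
    | add_left x y z _ _ _ h1 h2 =>
      obtain ⟨V, _, hV⟩ := h1
      obtain ⟨W, _, hW⟩ := h2
      exact ⟨V ⊔ W, inferInstance, fun t => by
        rw [add_mul, add_mul]; exact add_mem_sup (hV t) (hW t)⟩
    | add_right x y z _ _ _ h1 h2 =>
      obtain ⟨V, _, hV⟩ := h1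
      obtain ⟨W, _, hW⟩ := h2
      exact ⟨V ⊔ W, inferInstance, fun t => by
        rw [mul_add]; exact add_mem_sup (hV t) (hW t)⟩
    | smul_left r x y _ _ h =>
      obtain ⟨V, _, hV⟩ := h
      exact ⟨V, inferInstance, fun t => by
        rw [smul_mul_assoc, smul_mul_assoc]; exact V.smul_mem r (hV t)⟩
    | smul_right r x y _ _ h =>
      obtain ⟨V, _, hV⟩ := h
      exact ⟨V, inferInstance, fun t => by
        rw [mul_smul_comm]; exact V.smul_mem r (hV t)⟩
  obtain ⟨V, hVf, hV⟩ := key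
  obtain ⟨u, rfl⟩ := hu
  have htop : V = ⊤ := by
    refine eq_top_iff.2 fun x _ => ?_
    have := hV (↑u⁻¹ * x * ↑u⁻¹)
    simpa [mul_assoc] using this
  subst htop
  exact Module.Finite.equiv (Submodule.topEquiv (R := ℂ) (M := A))

end Simple

/-! ### Perfect subsets of the line -/

section Perfect

open Set

theorem exists_continuous_Icc_subset_image_of_perfect {K : Set ℝ} (hK : Perfect K)
    (hne : K.Nonempty) (h0 : (0 : ℝ) ∉ K) :
    ∃ G : ℝ → ℝ, Continuous G ∧ Icc 0 1 ⊆ (fun t => t * G t) '' K := by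
  obtain ⟨f, hfK, hfc, hfi⟩ := hK.exists_nat_bool_injection hne
  obtain ⟨ψ, hψ, hψs⟩ := exists_nat_bool_continuous_surjective_of_compact (Icc (0 : ℝ) 1)
  have hf0 : ∀ s, f s ≠ 0 := fun s h => h0 (h ▸ hfK ⟨s, rfl⟩)
  obtain ⟨G, hG⟩ := ContinuousMap.exists_extension' (hfc.isClosedEmbedding hfi)
    (⟨fun s => (ψ s : ℝ) / f s, by fun_prop (disch := exact hf0 _)⟩ : C(ℕ → Bool, ℝ))
  refine ⟨G, G.continuous, fun t ht => ?_⟩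
  obtain ⟨s, hs⟩ := hψs ⟨t, ht⟩
  refine ⟨f s, hfK ⟨s, rfl⟩, ?_⟩
  have := congrFun hG s
  simp only [Function.comp, ContinuousMap.coe_mk] at this
  simp only [this, hs]
  field_simp [hf0 s]

end Perfect
/-! ### Approximate eigenvectors -/

section ApproxEigenvector

theorem exists_mem_spectrum_abs_sub_le {a y : A} (ha : IsSelfAdjoint a) (hy : y ≠ 0) {μ η : ℝ}
    (hη : 0 < η) (h : ‖a * y - μ • y‖ ≤ η * ‖y‖) : ∃ ν ∈ spectrum ℝ a, |ν - μ| ≤ η := by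
  by_contra! H
  have hne : ∀ t ∈ spectrum ℝ a, t - μ ≠ 0 := fun t ht h0 => by
    have := H t ht
    rw [h0, abs_zero] at this
    exact absurd this hη.not_gt
  have hcont : ContinuousOn (fun t : ℝ => (t - μ)⁻¹) (spectrum ℝ a) := by
    fun_prop (disch := exact hne)
  have hR : cfc (fun t : ℝ => (t - μ)⁻¹) a * (a - algebraMap ℝ A μ) = 1 := by
    have : a - algebraMap ℝ A μ = cfc (fun t : ℝ => t - μ) a := by
      rw [cfc_sub (fun t : ℝ => t) (fun _ => μ) a, cfc_id' ℝ a, cfc_const μ a]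
    rw [this, ← cfc_mul _ _ a hcont (by fun_prop), ← cfc_const_one ℝ a]
    exact cfc_congr fun t ht => inv_mul_cancel₀ (hne t ht)
  have hn : ‖cfc (fun t : ℝ => (t - μ)⁻¹) a‖ < η⁻¹ := by
    refine norm_cfc_lt (inv_pos.2 hη) fun t ht => ?_
    rw [norm_inv, Real.norm_eq_abs]
    exact inv_strictAnti₀ hη (H t ht)
  have hy' : y = cfc (fun t : ℝ => (t - μ)⁻¹) a * (a * y - μ • y) := by
    conv_lhs => rw [← one_mul y, ← hR]
    rw [mul_assoc, sub_mul, Algebra.smul_def]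
  have hpos : 0 < ‖y‖ := norm_pos_iff.2 hy
  have : ‖y‖ < ‖y‖ := calc
    ‖y‖ = ‖cfc (fun t : ℝ => (t - μ)⁻¹) a * (a * y - μ • y)‖ := by rw [← hy']
    _ ≤ ‖cfc (fun t : ℝ => (t - μ)⁻¹) a‖ * (η * ‖y‖) :=
      (norm_mul_le _ _).trans (by gcongr)
    _ < η⁻¹ * (η * ‖y‖) := by gcongr
    _ = ‖y‖ := by field_simp
  exact lt_irrefl _ this

theorem mem_spectrum_of_forall_approx {a : A} (ha : IsSelfAdjoint a) {μ : ℝ}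
    (h : ∀ η > 0, ∃ y : A, y ≠ 0 ∧ ‖a * y - μ • y‖ ≤ η * ‖y‖) : μ ∈ spectrum ℝ a := by
  rw [← (spectrum.isClosed (𝕜 := ℝ) a).closure_eq, Metric.mem_closure_iff]
  intro η hη
  obtain ⟨y, hy, hle⟩ := h (η / 2) (half_pos hη)
  obtain ⟨ν, hν, hle⟩ := exists_mem_spectrum_abs_sub_le ha hy (half_pos hη) hle
  refine ⟨ν, hν, ?_⟩
  rw [dist_comm, Real.dist_eq]
  linarith

theorem exists_approx_eigenvector_cfc {a : A} (ha : IsSelfAdjoint a) {s : ℝ}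
    (hs : s ∈ spectrum ℝ a) {k : ℝ → ℝ} (hk : Continuous k) (hks : k s ≠ 0) {η : ℝ} (hη : 0 < η) :
    ∃ g : ℝ → ℝ, Continuous g ∧ cfc (fun t => k t * g t) a ≠ 0 ∧
      ‖a * cfc (fun t => k t * g t) a - s • cfc (fun t => k t * g t) a‖ ≤
        η * ‖cfc (fun t => k t * g t) a‖ := by
  refine ⟨fun t => max 0 (η - |t - s|), by fun_prop, ?_, ?_⟩
  · intro h0
    have := norm_apply_le_norm_cfc (fun t => k t * max 0 (η - |t - s|)) a hs
    rw [h0, norm_zero] at this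
    have h1 := norm_le_zero_iff.1 this
    simp [hks, hη.le, hη.ne'] at h1
  · have heq : a * cfc (fun t => k t * max 0 (η - |t - s|)) a -
        s • cfc (fun t => k t * max 0 (η - |t - s|)) a =
        cfc (fun t => (t - s) * (k t * max 0 (η - |t - s|))) a := by
      rw [cfc_mul (fun t => t - s) (fun t => k t * max 0 (η - |t - s|)) a,
        cfc_sub (fun t : ℝ => t) (fun _ => s) a, cfc_id' ℝ a, cfc_const s a, sub_mul,
        Algebra.smul_def]
    rw [heq]
    refine norm_cfc_le (by positivity) fun t ht => ?_
    have h1 := norm_apply_le_norm_cfc (fun t => k t * max 0 (η - |t - s|)) a ht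
    rcases le_total |t - s| η with h | h
    · rw [norm_mul]
      gcongr
      exact h
    · rw [max_eq_left (by linarith)]
      simp only [mul_zero, norm_zero]
      positivity

theorem exists_approx_eigenvector {a : A} (ha : IsSelfAdjoint a) {s : ℝ}
    (hs : s ∈ closure (spectrum ℝ a \ {0})) {η : ℝ} (hη : 0 < η) :
    ∃ y : A, a * y ≠ 0 ∧ ‖a * (a * y) - s • (a * y)‖ ≤ η * ‖a * y‖ := by
  obtain ⟨s', ⟨hs', hs0⟩, hd⟩ := Metric.mem_closure_iff.1 hs (η / 2) (half_pos hη)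
  obtain ⟨g, hg, h0, hle⟩ := exists_approx_eigenvector_cfc ha hs' (k := fun t => t) (by fun_prop)
    hs0 (half_pos hη)
  have heq : cfc (fun t => t * g t) a = a * cfc g a := by
    rw [cfc_mul (fun t : ℝ => t) g a, cfc_id' ℝ a]
  rw [heq] at h0 hle
  refine ⟨cfc g a, h0, ?_⟩
  set y := a * cfc g a
  have : a * y - s • y = (a * y - s' • y) + (s' - s) • y := by rw [sub_smul]; abel
  rw [this]
  refine (norm_add_le _ _).trans ?_
  rw [Real.dist_eq, abs_sub_comm] at hd
  rw [norm_smul, Real.norm_eq_abs]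
  nlinarith [norm_nonneg y]

theorem exists_mem_spectrum_of_norm_sub_lt {a b : A} (ha : IsSelfAdjoint a)
    (hb : IsSelfAdjoint b) {s η : ℝ} (hs : s ∈ spectrum ℝ a) (hab : ‖a - b‖ < η) :
    ∃ t ∈ spectrum ℝ b, |t - s| ≤ η := by
  obtain ⟨g, hg, h0, hle⟩ := exists_approx_eigenvector_cfc ha hs (k := fun _ => 1) (by fun_prop)
    one_ne_zero (sub_pos.2 hab)
  set y := cfc (fun t => 1 * g t) a
  refine exists_mem_spectrum_abs_sub_le hb h0 ((norm_nonneg _).trans_lt hab) ?_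
  have : b * y - s • y = (a * y - s • y) - (a - b) * y := by noncomm_ring
  rw [this]
  refine (norm_sub_le _ _).trans ?_
  have := norm_mul_le (a - b) y
  linarith

end ApproxEigenvector

/-! ### Elements with spectrum `[0, 1]` -/

section Interval

open Set

theorem IsSimpleCStarAlgebra.exists_isSelfAdjoint_mul_mul_not_smul (hA : IsSimpleCStarAlgebra A)
    (hinf : ¬ FiniteDimensional ℂ A) {c : A} (hc : c ≠ 0) :
    ∃ z : A, IsSelfAdjoint z ∧ ∀ r : ℝ, c * z * c ≠ r • c := by
  by_contra! H
  obtain ⟨z, hz⟩ := hA.exists_mul_mul_not_smul hinf hc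
  obtain ⟨r, hr⟩ := H _ (realPart z).2
  obtain ⟨s, hs⟩ := H _ (imaginaryPart z).2
  apply hz (r + Complex.I * s)
  conv_lhs => rw [← realPart_add_I_smul_imaginaryPart z]
  rw [mul_add, add_mul, hr, mul_smul_comm, smul_mul_assoc, hs, add_smul, mul_smul]
  simp

theorem IsSelfAdjoint.mul_self_eq_smul_of_spectrum_subset {w : A} (hw : IsSelfAdjoint w) {μ : ℝ}
    (h : ∀ t ∈ spectrum ℝ w, t ≠ 0 → t = μ) : w * w = μ • w := by
  have h1 : w * w = cfc (fun t : ℝ => t * t) w := by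
    rw [cfc_mul (fun t : ℝ => t) (fun t => t) w, cfc_id' ℝ w]
  have h2 : μ • w = cfc (fun t : ℝ => μ * t) w := by
    rw [cfc_const_mul μ (fun t => t) w, cfc_id' ℝ w]
  rw [h1, h2]
  refine cfc_congr fun t ht => ?_
  rcases eq_or_ne t 0 with rfl | h0
  · simp
  · simp [h t ht h0]

theorem IsSimpleCStarAlgebra.exists_two_mem_spectrum_of_projection (hA : IsSimpleCStarAlgebra A)
    (hinf : ¬ FiniteDimensional ℂ A) {p : A} (hp : IsSelfAdjoint p) (hpp : p * p = p)
    (hp0 : p ≠ 0) :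
    ∃ w : A, IsSelfAdjoint w ∧ p * w = w ∧ ∃ μ ∈ spectrum ℝ w, ∃ ν ∈ spectrum ℝ w,
      μ ≠ 0 ∧ ν ≠ 0 ∧ μ ≠ ν := by
  obtain ⟨z, hz, hzr⟩ := hA.exists_isSelfAdjoint_mul_mul_not_smul hinf hp0
  set b := p * z * p with hb
  have hbs : IsSelfAdjoint b := by
    have := hz.conjugate p
    rwa [hp.star_eq] at this
  have hpb : p * b = b := by rw [hb, ← mul_assoc, ← mul_assoc, hpp]
  have hbp : b * p = b := by rw [hb, mul_assoc, hpp]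
  by_contra! H
  have key : ∀ s : ℝ, ∃ μ : ℝ, (b + s • p) * (b + s • p) = μ • (b + s • p) := by
    intro s
    have hw : IsSelfAdjoint (b + s • p) := hbs.add ((IsSelfAdjoint.all s).smul hp)
    by_cases hμ : ∃ μ ∈ spectrum ℝ (b + s • p), μ ≠ 0
    · obtain ⟨μ, hμ, hμ0⟩ := hμ
      refine ⟨μ, hw.mul_self_eq_smul_of_spectrum_subset fun t ht ht0 => ?_⟩
      exact (H _ hw (by rw [mul_add, mul_smul_comm, hpb, hpp]) μ hμ t ht hμ0 ht0).symm
    · push Not at hμ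
      exact ⟨0, hw.mul_self_eq_smul_of_spectrum_subset fun t ht _ => hμ t ht⟩
  have key2 : ∀ s μ : ℝ, (b + s • p) * (b + s • p) = μ • (b + s • p) →
      b * b = (μ - 2 * s) • b + (μ * s - s * s) • p := by
    intro s μ h
    simp only [mul_add, add_mul, mul_smul_comm, smul_mul_assoc, hpb, hbp, hpp] at h
    have : b * b = μ • (b + s • p) - s • b - s • (b + s • p) := by
      rw [← h, smul_add]; abel
    rw [this]
    module
  obtain ⟨μ₀, h₀⟩ := key 0
  obtain ⟨μ₁, h₁⟩ := key 1
  obtain ⟨μ₂, h₂⟩ := key 2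
  have e₀ := key2 _ _ h₀
  have e₁ := key2 _ _ h₁
  have e₂ := key2 _ _ h₂
  have indep : ∀ x y : ℝ, x • b = y • p → x = 0 ∧ y = 0 := by
    intro x y hxy
    have hx : x = 0 := by
      by_contra hx
      apply hzr (x⁻¹ * y)
      rw [mul_smul, ← hxy, smul_smul, inv_mul_cancel₀ hx, one_smul]
    refine ⟨hx, ?_⟩
    rw [hx, zero_smul] at hxy
    exact (smul_eq_zero.1 hxy.symm).resolve_right hp0
  rw [e₀] at e₁ e₂
  have f₁ := indep (μ₀ - (μ₁ - 2)) (μ₁ - 1) (by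
    rw [← sub_eq_zero] at e₁ ⊢; rw [← e₁]; module)
  have f₂ := indep (μ₀ - (μ₂ - 4)) (μ₂ * 2 - 4) (by
    rw [← sub_eq_zero] at e₂ ⊢; rw [← e₂]; module)
  obtain ⟨a1, b1⟩ := f₁
  obtain ⟨a2, b2⟩ := f₂
  linarith

end Interval
section Interval

open Set Topology

theorem IsSelfAdjoint.exists_projection_of_isolated {a : A} (ha : IsSelfAdjoint a) {s ρ : ℝ}
    (hρ : 0 < ρ) (hs : s ∈ spectrum ℝ a) (hiso : ∀ t ∈ spectrum ℝ a, t ≠ s → ρ ≤ |t - s|) :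
    ∃ p : A, IsSelfAdjoint p ∧ p * p = p ∧ p ≠ 0 ∧ a * p = s • p := by
  set g : ℝ → ℝ := fun t => max 0 (1 - |t - s| / ρ) with hg
  have hgc : Continuous g := by fun_prop
  have hgs : g s = 1 := by simp [hg]
  have hg0 : ∀ t ∈ spectrum ℝ a, t ≠ s → g t = 0 := fun t ht hne => by
    have := (one_le_div hρ).2 (hiso t ht hne)
    exact max_eq_left (by linarith)
  refine ⟨cfc g a, cfc_predicate g a, ?_, ?_, ?_⟩
  · rw [← cfc_mul g g a]
    refine cfc_congr fun t ht => ?_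
    rcases eq_or_ne t s with rfl | h
    · simp [hgs]
    · simp [hg0 t ht h]
  · intro h0
    have := norm_apply_le_norm_cfc g a hs
    rw [h0, hgs] at this
    norm_num at this
  · rw [← cfc_const_mul s g a]
    nth_rewrite 1 [← cfc_id' ℝ a]
    rw [← cfc_mul (fun t : ℝ => t) g a]
    refine cfc_congr fun t ht => ?_
    rcases eq_or_ne t s with rfl | h
    · rfl
    · simp [hg0 t ht h]

theorem IsSimpleCStarAlgebra.exists_spectrum_without_isolated_points
    (hA : IsSimpleCStarAlgebra A) (hinf : ¬ FiniteDimensional ℂ A) {e b : A}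
    (hb : IsSelfAdjoint b) (hb0 : b ≠ 0) (heb : e * b = b) :
    ∃ a : A, IsSelfAdjoint a ∧ a ≠ 0 ∧ e * a = a ∧
      ∀ s ∈ spectrum ℝ a, s ≠ 0 → ∀ ρ > 0, ∃ t ∈ spectrum ℝ a, t ≠ s ∧ |t - s| < ρ := by
  set S : Set A := {a | IsSelfAdjoint a ∧ e * a = a} with hS
  have hSc : IsClosed S :=
    (isClosed_eq continuous_star continuous_id).inter (isClosed_eq (by fun_prop) continuous_id)
  have : CompleteSpace S := hSc.completeSpace_coe
  set U : ℚ × ℚ → Set S := fun r => {a | ∃ s ∈ spectrum ℝ (a : A), ∃ t ∈ spectrum ℝ (a : A),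
    s ≠ t ∧ s ∈ Ioo (r.1 : ℝ) r.2 ∧ t ∈ Ioo (r.1 : ℝ) r.2} with hU
  have hUo : ∀ r, IsOpen (U r) := by
    intro r
    rw [Metric.isOpen_iff]
    rintro a ⟨s, hs, t, ht, hst, ⟨hs1, hs2⟩, ⟨ht1, ht2⟩⟩
    obtain ⟨η, hη, h1, h2, h3, h4, h5⟩ : ∃ η > 0, η < s - r.1 ∧ η < r.2 - s ∧ η < t - r.1 ∧
        η < r.2 - t ∧ 2 * η < |s - t| := by
      have hpos : 0 < |s - t| := abs_pos.2 (sub_ne_zero.2 hst)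
      have : ∀ᶠ η in 𝓝[>] (0 : ℝ), 0 < η ∧ η < s - r.1 ∧ η < r.2 - s ∧ η < t - r.1 ∧
          η < r.2 - t ∧ η < |s - t| / 2 := by
        refine Filter.Eventually.and self_mem_nhdsWithin ?_
        refine nhdsWithin_le_nhds ?_
        exact (eventually_lt_nhds (by linarith)).and ((eventually_lt_nhds (by linarith)).and
          ((eventually_lt_nhds (by linarith)).and ((eventually_lt_nhds (by linarith)).and
          (eventually_lt_nhds (half_pos hpos)))))
      obtain ⟨η, h⟩ := this.exists
      exact ⟨η, h.1, h.2.1, h.2.2.1, h.2.2.2.1, h.2.2.2.2.1, by linarith [h.2.2.2.2.2]⟩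
    refine ⟨η, hη, fun c hc => ?_⟩
    have hn : ‖(a : A) - c‖ < η := by
      rw [Metric.mem_ball, dist_comm, Subtype.dist_eq, dist_eq_norm] at hc
      exact hc
    obtain ⟨s', hs', hss⟩ := exists_mem_spectrum_of_norm_sub_lt a.2.1 c.2.1 hs hn
    obtain ⟨t', ht', htt⟩ := exists_mem_spectrum_of_norm_sub_lt a.2.1 c.2.1 ht hn
    have hss' := abs_le.1 hss
    have htt' := abs_le.1 htt
    refine ⟨s', hs', t', ht', ?_, ⟨?_, ?_⟩, ⟨?_, ?_⟩⟩ <;> try linarith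
    rintro rfl
    have h6 : |s - t| ≤ |s' - s| + |s' - t| := by
      rw [abs_sub_comm s' s]; exact abs_sub_le _ _ _
    linarith
  have hG : Dense (⋂ r, (frontier (U r))ᶜ) := by
    refine dense_iInter_of_isOpen (fun r => isClosed_frontier.isOpen_compl) fun r => ?_
    rw [← interior_eq_empty_iff_dense_compl, ← frontier_compl]
    exact interior_frontier (hUo r).isClosed_compl
  have hbpos : 0 < ‖b‖ := norm_pos_iff.2 hb0
  obtain ⟨a, haG, hab⟩ := hG.exists_dist_lt (⟨b, hb, heb⟩ : S) hbpos
  refine ⟨a, a.2.1, ?_, a.2.2, ?_⟩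
  · intro h0
    rw [Subtype.dist_eq, h0, dist_zero_right] at hab
    exact lt_irrefl _ hab
  intro s hs hs0 ρ hρ
  by_contra! H
  obtain ⟨p, hp, hpp, hp0, hap⟩ := a.2.1.exists_projection_of_isolated hρ hs H
  obtain ⟨w, hw, hpw, μ, hμ, ν, hν, hμ0, hν0, hμν⟩ :=
    hA.exists_two_mem_spectrum_of_projection hinf hp hpp hp0
  have hep : e * p = p := by
    have h1 : p = s⁻¹ • ((a : A) * p) := by rw [hap, smul_smul, inv_mul_cancel₀ hs0, one_smul]
    rw [h1, mul_smul_comm, ← mul_assoc, a.2.2]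
  have hew : e * w = w := by rw [← hpw, ← mul_assoc, hep]
  have haw : (a : A) * w = s • w := by
    rw [← hpw, ← mul_assoc, hap, smul_mul_assoc]
  obtain ⟨x, hx1, hx2⟩ := exists_rat_btwn (sub_lt_self s hρ)
  obtain ⟨y, hy1, hy2⟩ := exists_rat_btwn (lt_add_of_pos_right s hρ)
  have haU : a ∉ U (x, y) := by
    rintro ⟨t, ht, t', ht', hne, ⟨h1, h2⟩, ⟨h3, h4⟩⟩
    simp only at h1 h2 h3 h4
    have aux : ∀ t ∈ spectrum ℝ (a : A), (x : ℝ) < t → t < y → t = s := by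
      intro t ht h1 h2
      by_contra hts
      have := H t ht hts
      rcases abs_cases (t - s) with h | h <;> linarith
    exact hne ((aux t ht h1 h2).trans (aux t' ht' h3 h4).symm)
  have hacl : a ∉ closure (U (x, y)) := by
    intro hcl
    have := mem_iInter.1 haG (x, y)
    rw [(hUo _).frontier_eq] at this
    exact this ⟨hcl, haU⟩
  apply hacl
  have hmem : ∀ τ : ℝ, (a : A) + τ • w ∈ S := fun τ =>
    ⟨a.2.1.add ((IsSelfAdjoint.all τ).smul hw), by rw [mul_add, mul_smul_comm, hew, a.2.2]⟩
  set γ : ℝ → S := fun τ => ⟨(a : A) + τ • w, hmem τ⟩ with hγ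
  have hγc : Continuous γ := by
    refine Continuous.subtype_mk ?_ _
    fun_prop
  have hγ0 : γ 0 = a := by ext; simp [hγ]
  have hspec : ∀ τ : ℝ, ∀ μ ∈ spectrum ℝ w, μ ≠ 0 → s + τ * μ ∈ spectrum ℝ ((γ τ : S) : A) := by
    intro τ μ hμ hμ0
    refine mem_spectrum_of_forall_approx (γ τ).2.1 fun η hη => ?_
    obtain ⟨z, hz, hle⟩ := exists_approx_eigenvector hw (subset_closure ⟨hμ, hμ0⟩)
      (show 0 < η / (|τ| + 1) by positivity)
    refine ⟨w * z, hz, ?_⟩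
    have : ((a : A) + τ • w) * (w * z) - (s + τ * μ) • (w * z) =
        τ • (w * (w * z) - μ • (w * z)) := by
      rw [add_mul, ← mul_assoc (a : A), haw]
      simp only [smul_mul_assoc, smul_sub, add_smul, mul_smul]
      abel
    simp only [hγ]
    rw [this, norm_smul, Real.norm_eq_abs]
    calc |τ| * ‖w * (w * z) - μ • (w * z)‖ ≤ (|τ| + 1) * (η / (|τ| + 1) * ‖w * z‖) := by
          gcongr
          linarith
      _ = η * ‖w * z‖ := by field_simp
  have hlim : Filter.Tendsto γ (𝓝[>] 0) (𝓝 a) := by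
    have := hγc.tendsto 0
    rw [hγ0] at this
    exact this.mono_left nhdsWithin_le_nhds
  refine mem_closure_of_tendsto hlim ?_
  have hnear : ∀ μ : ℝ, ∀ᶠ τ in 𝓝[>] (0 : ℝ), s + τ * μ ∈ Ioo (x : ℝ) y := by
    intro μ
    refine nhdsWithin_le_nhds ?_
    have hc : Continuous fun τ : ℝ => s + τ * μ := by fun_prop
    refine hc.continuousAt.preimage_mem_nhds (isOpen_Ioo.mem_nhds ?_)
    simp only [zero_mul, add_zero]
    exact ⟨hx2, hy1⟩
  filter_upwards [hnear μ, hnear ν, self_mem_nhdsWithin] with τ h1 h2 hτ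
  refine ⟨_, hspec τ μ hμ hμ0, _, hspec τ ν hν hν0, ?_, h1, h2⟩
  intro h
  exact hμν (mul_left_cancel₀ (ne_of_gt hτ) (add_left_cancel h))

theorem IsSimpleCStarAlgebra.exists_spectrum_eq_Icc
    (hA : IsSimpleCStarAlgebra A) (hinf : ¬ FiniteDimensional ℂ A) {e b : A}
    (hb : IsSelfAdjoint b) (hb0 : b ≠ 0) (heb : e * b = b) :
    ∃ c : A, IsSelfAdjoint c ∧ e * c = c ∧ spectrum ℝ c = Icc 0 1 := by
  obtain ⟨a, ha, ha0, hea, hiso⟩ := hA.exists_spectrum_without_isolated_points hinf hb hb0 heb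
  obtain ⟨s, hs, hs0⟩ : ∃ s ∈ spectrum ℝ a, s ≠ 0 := by
    by_contra! H
    apply ha0
    rw [← cfc_id' ℝ a, ← cfc_zero ℝ a]
    exact cfc_congr fun t ht => H t ht
  have hpre : Preperfect (spectrum ℝ a \ {0}) := by
    rw [preperfect_iff_nhds]
    rintro t ⟨ht, ht0⟩ V hV
    obtain ⟨ρ, hρ, hρV⟩ := Metric.mem_nhds_iff.1 hV
    have ht0 : t ≠ 0 := ht0
    obtain ⟨r, hr, hrt, hlt⟩ := hiso t ht ht0 (min ρ |t|) (lt_min hρ (abs_pos.2 ht0))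
    refine ⟨r, ⟨hρV ?_, hr, ?_⟩, hrt⟩
    · rw [Metric.mem_ball, Real.dist_eq]
      exact hlt.trans_le (min_le_left _ _)
    · rintro rfl
      simp at hlt
  set C := closure (Metric.ball s (|s| / 2) ∩ (spectrum ℝ a \ {0})) with hC
  have hCp : Perfect C := (hpre.open_inter Metric.isOpen_ball).perfect_closure
  have hs2 : 0 < |s| / 2 := half_pos (abs_pos.2 hs0)
  have hCn : C.Nonempty := ⟨s, subset_closure ⟨Metric.mem_ball_self hs2, hs, hs0⟩⟩
  have hCs : C ⊆ spectrum ℝ a :=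
    closure_minimal (fun t ht => ht.2.1) (spectrum.isClosed (𝕜 := ℝ) a)
  have hC0 : (0 : ℝ) ∉ C := by
    intro h
    have : (0 : ℝ) ∈ Metric.closedBall s (|s| / 2) :=
      closure_minimal (fun t ht => Metric.ball_subset_closedBall ht.1) Metric.isClosed_closedBall h
    rw [Metric.mem_closedBall, Real.dist_eq, zero_sub, abs_neg] at this
    linarith
  obtain ⟨G, hG, hGC⟩ := exists_continuous_Icc_subset_image_of_perfect hCp hCn hC0
  set k : ℝ → ℝ := fun t => t * (G t * (t * G t) / max 1 ((t * G t) ^ 2)) with hk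
  have hmax : ∀ t, max 1 ((t * G t) ^ 2) ≠ 0 := fun t =>
    (lt_of_lt_of_le one_pos (le_max_left _ _)).ne'
  have hk' : Continuous fun t => G t * (t * G t) / max 1 ((t * G t) ^ 2) := by
    fun_prop (disch := exact hmax _)
  have hkc : Continuous k := by fun_prop
  have hkeq : ∀ t, k t = (t * G t) ^ 2 / max 1 ((t * G t) ^ 2) := fun t => by
    simp only [hk]; ring
  refine ⟨cfc k a, cfc_predicate k a, ?_, ?_⟩
  · rw [hk, cfc_mul (fun t : ℝ => t) _ a, cfc_id' ℝ a, ← mul_assoc, hea]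
  · rw [cfc_map_spectrum k a]
    refine Subset.antisymm ?_ ?_
    · rintro _ ⟨t, -, rfl⟩
      rw [hkeq]
      refine ⟨by positivity, ?_⟩
      exact div_le_one_of_le₀ (le_max_right _ _) (by positivity)
    · intro r hr
      obtain ⟨t, ht, htr⟩ := hGC (show √r ∈ Icc (0 : ℝ) 1 from
        ⟨Real.sqrt_nonneg _, Real.sqrt_le_one.2 hr.2⟩)
      refine ⟨t, hCs ht, ?_⟩
      simp only at htr
      rw [hkeq, htr, Real.sq_sqrt hr.1, max_eq_left hr.2, div_one]

end Interval
/-! ### Square-zero elements and unitaries -/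

section SquareZero

open Set

theorem IsSimpleCStarAlgebra.exists_mul_self_eq_zero (hA : IsSimpleCStarAlgebra A)
    {p f q g : A} (hp : IsSelfAdjoint p) (hf : IsSelfAdjoint f)
    (hf0 : f ≠ 0) (hg0 : g ≠ 0) (hpf : p * f = f) (hqg : q * g = g) (hfg : f * g = 0) :
    ∃ w y : A, IsSelfAdjoint y ∧ y ≠ 0 ∧ star w * w * y = y ∧ w * w = 0 ∧ q * w = w ∧
      w * p = w := by
  obtain ⟨z, hz⟩ := hA.exists_mul_mul_ne_zero hf0 hg0
  set x := g * z * f with hx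
  have hqx : q * x = x := by rw [hx, ← mul_assoc, ← mul_assoc, hqg]
  have hfp : f * p = f := by
    have := congrArg star hpf
    rwa [star_mul, hp.star_eq, hf.star_eq] at this
  have hxp : x * p = x := by rw [hx, mul_assoc, hfp]
  have hxx : x * x = 0 := by
    have : x * x = g * z * (f * g) * (z * f) := by simp only [hx, mul_assoc]
    rw [this, hfg]; simp
  set d := star x * x with hd
  have hds : IsSelfAdjoint d := IsSelfAdjoint.star_mul_self x
  have hdx : d * x = 0 := by rw [hd, mul_assoc, hxx, mul_zero]
  have hdp : d * p = d := by rw [hd, mul_assoc, hxp]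
  have hd0 : 0 < ‖d‖ := by
    rw [hd, CStarRing.norm_star_mul_self]
    have := norm_pos_iff.2 hz
    positivity
  set c := ‖d‖ / 2 with hc
  have hc0 : 0 < c := half_pos hd0
  obtain ⟨m, hmc, hm⟩ : ∃ m : ℝ → ℝ, Continuous m ∧ ∀ t, c ≤ t → m t * t * t * (m t * t) = 1 := by
    have hmax : ∀ t, 0 < max t c := fun t => hc0.trans_le (le_max_right _ _)
    refine ⟨fun t => (max t c * √(max t c))⁻¹, Continuous.inv₀ (by fun_prop) fun t =>
      (mul_pos (hmax t) (Real.sqrt_pos.2 (hmax t))).ne', fun t ht => ?_⟩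
    have ht0 : 0 < t := hc0.trans_le ht
    have h2 := Real.sq_sqrt ht0.le
    have h3 := Real.sqrt_pos.2 ht0
    simp only [max_eq_left ht]
    field_simp
    exact h2.symm
  obtain ⟨k, hkc, hk⟩ : ∃ k : ℝ → ℝ, Continuous k ∧ k = fun t => m t * t :=
    ⟨_, by fun_prop, rfl⟩
  have hK1 : cfc k d = cfc m d * d := by
    rw [hk, cfc_mul m (fun t : ℝ => t) d, cfc_id' ℝ d]
  have hKs : IsSelfAdjoint (cfc k d) := cfc_predicate k d
  have hww : star (x * cfc k d) * (x * cfc k d) = cfc (fun t => k t * t * k t) d := by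
    rw [cfc_mul (fun t => k t * t) k d, cfc_mul k (fun t => t) d, cfc_id' ℝ d, star_mul,
      hKs.star_eq, hd]
    simp only [mul_assoc]
  refine ⟨x * cfc k d, cfc (fun t => max 0 (t - c)) d, cfc_predicate _ _, ?_, ?_, ?_, ?_, ?_⟩
  · intro h0
    have hle : ‖d‖ ≤ c := by
      conv_lhs => rw [← cfc_id' ℝ d]
      refine norm_cfc_le hc0.le fun t ht => ?_
      have h1 := norm_apply_le_norm_cfc (fun t => max 0 (t - c)) d ht
      rw [h0, norm_zero, norm_le_zero_iff] at h1
      have h2 : 0 ≤ t := spectrum_star_mul_self_nonneg t ht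
      rw [Real.norm_of_nonneg h2]
      exact sub_nonpos.1 (max_eq_left_iff.1 h1)
    linarith
  · rw [hww, ← cfc_mul (fun t => k t * t * k t) (fun t => max 0 (t - c)) d]
    refine cfc_congr fun t ht => ?_
    rcases le_total t c with h | h
    · simp only [max_eq_left (sub_nonpos.2 h), mul_zero]
    · simp only [hk, hm t h, one_mul]
  · calc x * cfc k d * (x * cfc k d) = x * cfc m d * (d * x) * cfc k d := by
          rw [hK1]; simp only [mul_assoc]
      _ = 0 := by rw [hdx]; simp
  · rw [← mul_assoc, hqx]
  · rw [hK1, mul_assoc x, mul_assoc (cfc m d), hdp]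

theorem IsSimpleCStarAlgebra.exists_mul_self_eq_zero_spectrum_eq_Icc
    (hA : IsSimpleCStarAlgebra A) (hinf : ¬ FiniteDimensional ℂ A) {e b : A}
    (he : IsSelfAdjoint e) (hb : IsSelfAdjoint b) (hb0 : b ≠ 0) (heb : e * b = b) :
    ∃ x : A, e * x = x ∧ x * e = x ∧ x * x = 0 ∧ spectrum ℝ (star x * x) = Icc 0 1 := by
  obtain ⟨c, hc, hec, hcs⟩ := hA.exists_spectrum_eq_Icc hinf hb hb0 heb
  have hid : ∀ k : ℝ → ℝ, Continuous k → e * cfc (fun t => t * k t) c = cfc (fun t => t * k t) c :=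
    fun k hk => by rw [cfc_mul (fun t : ℝ => t) k c, cfc_id' ℝ c, ← mul_assoc, hec]
  have hne : ∀ (k : ℝ → ℝ) (t : ℝ), Continuous k → t ∈ Icc (0 : ℝ) 1 → t * k t ≠ 0 →
      cfc (fun t => t * k t) c ≠ 0 := by
    intro k t hk ht hkt h0
    have := norm_apply_le_norm_cfc (fun t => t * k t) c (by rwa [hcs] : t ∈ spectrum ℝ c)
    rw [h0, norm_zero, norm_le_zero_iff] at this
    exact hkt this
  obtain ⟨w, y, hy, hy0, hwy, hww, hew, hwe⟩ := hA.exists_mul_self_eq_zero he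
    (f := cfc (fun t : ℝ => t * max 0 (1 / 2 - t)) c)
    (g := cfc (fun t : ℝ => t * max 0 (t - 1 / 2)) c) (q := e) (cfc_predicate _ _)
    (hne _ (1 / 4) (by fun_prop) (by norm_num) (by norm_num))
    (hne _ 1 (by fun_prop) (by norm_num) (by norm_num))
    (hid _ (by fun_prop)) (hid _ (by fun_prop)) (by
      rw [← cfc_mul _ _ c, ← cfc_zero ℝ c]
      refine cfc_congr fun t _ => ?_
      rcases le_total t (1 / 2) with h | h
      · simp only [max_eq_left (sub_nonpos.2 h), mul_zero]; rfl
      · simp only [max_eq_left (sub_nonpos.2 h), mul_zero, zero_mul]; rfl)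
  obtain ⟨v, hv, hwv, hvs⟩ := hA.exists_spectrum_eq_Icc hinf hy hy0 hwy
  have hvw : v * (star w * w) = v := by
    have := congrArg star hwv
    rwa [star_mul, star_mul, star_star, hv.star_eq] at this
  have hvw0 : v * w = 0 := by
    rw [← hvw, mul_assoc, mul_assoc, hww, mul_zero, mul_zero]
  refine ⟨w * v, ?_, ?_, ?_, ?_⟩
  · rw [← mul_assoc, hew]
  · have : v * e = v := by
      nth_rewrite 1 [← hvw]
      rw [mul_assoc, mul_assoc, hwe, hvw]
    rw [mul_assoc, this]
  · rw [mul_assoc, ← mul_assoc v, hvw0]; simp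
  · have : star (w * v) * (w * v) = cfc (fun t : ℝ => t * t) v := by
      rw [cfc_mul (fun t : ℝ => t) (fun t => t) v, cfc_id' ℝ v, star_mul, hv.star_eq, mul_assoc,
        ← mul_assoc (star w), hwv]
    rw [this, cfc_map_spectrum (fun t : ℝ => t * t) v, hvs]
    ext r
    constructor
    · rintro ⟨t, ⟨h0, h1⟩, rfl⟩
      exact ⟨mul_nonneg h0 h0, mul_le_one₀ h1 h0 h1⟩
    · rintro ⟨h0, h1⟩
      exact ⟨√r, ⟨Real.sqrt_nonneg _, Real.sqrt_le_one.2 h1⟩, Real.mul_self_sqrt h0⟩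

theorem IsSelfAdjoint.exists_unitary_mul_eq {d : A} (hd : IsSelfAdjoint d) :
    ∃ u : unitary A, ∀ y, d * (d * y) = y →
      (u : A) * y = Complex.I • (d * y) ∧ star (u : A) * y = -Complex.I • (d * y) := by
  have hpos : ∀ t : ℝ, 1 + t ^ 2 ≠ 0 := fun t => by positivity
  have hcont : ∀ k : ℝ → ℝ, Continuous k → Continuous fun t => k t / (1 + t ^ 2) := fun k hk => by
    fun_prop (disch := exact hpos _)
  set c : ℝ → ℝ := fun t => (1 - t ^ 2) / (1 + t ^ 2) with hc
  set s : ℝ → ℝ := fun t => (2 * t) / (1 + t ^ 2) with hs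
  have hcc : Continuous c := hcont _ (by fun_prop)
  have hsc : Continuous s := hcont _ (by fun_prop)
  set C := cfc c d with hC
  set S := cfc s d with hS
  have hCs : star C = C := (cfc_predicate c d : IsSelfAdjoint C).star_eq
  have hSs : star S = S := (cfc_predicate s d : IsSelfAdjoint S).star_eq
  have hcomm : C * S = S * C := by
    rw [hC, hS, ← cfc_mul c s d, ← cfc_mul s c d]
    simp only [mul_comm]
  have hone : C * C + S * S = 1 := by
    rw [hC, hS, ← cfc_mul c c d, ← cfc_mul s s d, ← cfc_add d (fun t => c t * c t)
      (fun t => s t * s t), ← cfc_const_one ℝ d]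
    refine cfc_congr fun t _ => ?_
    have := hpos t
    simp only [hc, hs]
    field_simp
    ring
  have hstar : star (C + Complex.I • S) = C - Complex.I • S := by
    rw [star_add, star_smul, hCs, hSs]
    simp [sub_eq_add_neg]
  have hu : C + Complex.I • S ∈ unitary A := by
    rw [Unitary.mem_iff, hstar]
    constructor
    · rw [sub_mul, mul_add, mul_add, smul_mul_smul_comm, Complex.I_mul_I, mul_smul_comm,
        smul_mul_assoc, hcomm, ← hone, neg_one_smul]
      abel
    · rw [add_mul, mul_sub, mul_sub, smul_mul_smul_comm, Complex.I_mul_I, mul_smul_comm,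
        smul_mul_assoc, hcomm, ← hone, neg_one_smul]
      abel
  have hfac : ∀ k : ℝ → ℝ, Continuous k →
      cfc (fun t => k t * (1 - t * t)) d = cfc k d * (1 - d * d) := by
    intro k hk
    rw [cfc_mul k (fun t => 1 - t * t) d, cfc_sub (fun _ : ℝ => (1 : ℝ)) (fun t => t * t) d,
      cfc_mul (fun t : ℝ => t) (fun t => t) d, cfc_id' ℝ d, cfc_const_one ℝ d]
  refine ⟨⟨C + Complex.I • S, hu⟩, fun y hy => ?_⟩
  have hy0 : (1 - d * d) * y = 0 := by rw [sub_mul, one_mul, mul_assoc, hy, sub_self]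
  have hCy : C * y = 0 := by
    have : C = cfc (fun t : ℝ => 1 / (1 + t ^ 2) * (1 - t * t)) d := by
      refine cfc_congr fun t _ => ?_
      simp only [hc]
      ring
    rw [this, hfac _ (hcont _ (by fun_prop)), mul_assoc, hy0, mul_zero]
  have hSy : S * y = d * y := by
    have : S - d = cfc (fun t : ℝ => t / (1 + t ^ 2) * (1 - t * t)) d := by
      have hsub := cfc_sub s (fun t : ℝ => t) d
      rw [cfc_id' ℝ d] at hsub
      rw [hS, ← hsub]
      refine cfc_congr fun t _ => ?_
      have := hpos t
      simp only [hs]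
      field_simp
      ring
    rw [← sub_eq_zero, ← sub_mul, this, hfac _ (hcont _ (by fun_prop)), mul_assoc, hy0, mul_zero]
  refine ⟨?_, ?_⟩
  · rw [add_mul, hCy, smul_mul_assoc, hSy, zero_add]
  · rw [hstar, sub_mul, hCy, smul_mul_assoc, hSy, zero_sub, neg_smul]

end SquareZero
/-! ### Localization at a point of the spectrum -/

section Localization

open Set

/-- The tent function of height one supported in the ball of radius `ρ` around `s`. -/
def tent (s ρ t : ℝ) : ℝ := max 0 (1 - |t - s| / ρ)

/-- The trapezoidal function equal to one in the ball of radius `ρ` around `s`, supported in the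
ball of radius `2ρ`. -/
def plateau (s ρ t : ℝ) : ℝ := max 0 (min 1 (2 - |t - s| / ρ))

theorem continuous_tent (s ρ : ℝ) : Continuous (tent s ρ) := by
  unfold tent; fun_prop

theorem continuous_plateau (s ρ : ℝ) : Continuous (plateau s ρ) := by
  unfold plateau; fun_prop

theorem tent_self (s ρ : ℝ) : tent s ρ s = 1 := by simp [tent]

theorem tent_eq_zero {s ρ t : ℝ} (hρ : 0 < ρ) (h : ρ ≤ |t - s|) : tent s ρ t = 0 := by
  have := (one_le_div hρ).2 h
  exact max_eq_left (by linarith)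

theorem plateau_nonneg (s ρ t : ℝ) : 0 ≤ plateau s ρ t := le_max_left _ _

theorem plateau_le_one (s ρ t : ℝ) : plateau s ρ t ≤ 1 := max_le zero_le_one (min_le_left _ _)

theorem plateau_eq_zero {s ρ t : ℝ} (hρ : 0 < ρ) (h : 2 * ρ ≤ |t - s|) : plateau s ρ t = 0 := by
  have := (le_div_iff₀ hρ).2 h
  exact max_eq_left ((min_le_right _ _).trans (by linarith))

theorem plateau_eq_one {s ρ t : ℝ} (hρ : 0 < ρ) (h : |t - s| ≤ ρ) : plateau s ρ t = 1 := by
  have := (div_le_one hρ).2 h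
  rw [plateau, min_eq_left (by linarith), max_eq_right zero_le_one]

theorem abs_sub_mul_plateau_le {s ρ : ℝ} (hρ : 0 < ρ) (t : ℝ) :
    |(t - s) * plateau s ρ t| ≤ 2 * ρ := by
  rcases le_total (2 * ρ) |t - s| with h | h
  · rw [plateau_eq_zero hρ h, mul_zero, abs_zero]; positivity
  · rw [abs_mul, abs_of_nonneg (plateau_nonneg s ρ t)]
    exact (mul_le_of_le_one_right (abs_nonneg _) (plateau_le_one _ _ _)).trans h

theorem plateau_mul_tent {s ρ : ℝ} (hρ : 0 < ρ) (t : ℝ) :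
    plateau s ρ t * tent s ρ t = tent s ρ t := by
  rcases le_total ρ |t - s| with h | h
  · rw [tent_eq_zero hρ h, mul_zero]
  · rw [plateau_eq_one hρ h, one_mul]

theorem cfc_plateau_mul_cfc_tent {s ρ : ℝ} (hρ : 0 < ρ) (h : A) :
    cfc (plateau s ρ) h * cfc (tent s ρ) h = cfc (tent s ρ) h := by
  rw [← cfc_mul _ _ h (continuous_plateau s ρ).continuousOn (continuous_tent s ρ).continuousOn]
  exact cfc_congr fun t _ => plateau_mul_tent hρ t

theorem cfc_tent_ne_zero {h : A} (hh : IsSelfAdjoint h) {s : ℝ} (hs : s ∈ spectrum ℝ h) (ρ : ℝ) :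
    cfc (tent s ρ) h ≠ 0 := by
  intro h0
  have := norm_apply_le_norm_cfc (tent s ρ) h hs (continuous_tent s ρ).continuousOn
  rw [h0, tent_self] at this
  norm_num at this

theorem mul_cfc_plateau_sub {h : A} (hh : IsSelfAdjoint h) (s ρ : ℝ) :
    h * cfc (plateau s ρ) h - s • cfc (plateau s ρ) h =
      cfc (fun t => (t - s) * plateau s ρ t) h := by
  have hc := continuous_plateau s ρ
  rw [cfc_mul (fun t => t - s) (plateau s ρ) h, cfc_sub (fun t : ℝ => t) (fun _ => s) h,
    cfc_id' ℝ h, cfc_const s h, sub_mul, Algebra.smul_def]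

theorem norm_mul_sub_smul_le_of_plateau_mul {h : A} (hh : IsSelfAdjoint h) {s ρ : ℝ} (hρ : 0 < ρ)
    {y : A} (hy : cfc (plateau s ρ) h * y = y) : ‖h * y - s • y‖ ≤ 2 * ρ * ‖y‖ := by
  have hle : ‖h * cfc (plateau s ρ) h - s • cfc (plateau s ρ) h‖ ≤ 2 * ρ := by
    rw [mul_cfc_plateau_sub hh]
    exact norm_cfc_le (by positivity) fun t _ => abs_sub_mul_plateau_le hρ t
  have : h * y - s • y = (h * cfc (plateau s ρ) h - s • cfc (plateau s ρ) h) * y := by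
    rw [sub_mul, smul_mul_assoc, mul_assoc, hy]
  rw [this]
  exact (norm_mul_le _ _).trans (by gcongr)

end Localization

/-! ### Averaging with a unitary conjugate -/

section Averaging

open Set

theorem IsSelfAdjoint.algebraMap_sInf_le [PartialOrder A] [StarOrderedRing A] {h : A}
    (hh : IsSelfAdjoint h) :
    algebraMap ℝ A (sInf (spectrum ℝ h)) ≤ h :=
  (algebraMap_le_iff_le_spectrum hh).2 fun _ ht =>
    csInf_le (ContinuousFunctionalCalculus.isCompact_spectrum h).bddBelow ht

theorem IsSelfAdjoint.le_algebraMap_sSup [PartialOrder A] [StarOrderedRing A] {h : A}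
    (hh : IsSelfAdjoint h) :
    h ≤ algebraMap ℝ A (sSup (spectrum ℝ h)) :=
  (le_algebraMap_iff_spectrum_le hh).2 fun _ ht =>
    le_csSup (ContinuousFunctionalCalculus.isCompact_spectrum h).bddAbove ht

theorem IsSelfAdjoint.sInf_mem_spectrum [Nontrivial A] {h : A} (hh : IsSelfAdjoint h) :
    sInf (spectrum ℝ h) ∈ spectrum ℝ h :=
  (ContinuousFunctionalCalculus.isCompact_spectrum h).sInf_mem
    (ContinuousFunctionalCalculus.spectrum_nonempty h hh)

theorem IsSelfAdjoint.sSup_mem_spectrum [Nontrivial A] {h : A} (hh : IsSelfAdjoint h) :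
    sSup (spectrum ℝ h) ∈ spectrum ℝ h :=
  (ContinuousFunctionalCalculus.isCompact_spectrum h).sSup_mem
    (ContinuousFunctionalCalculus.spectrum_nonempty h hh)

theorem IsSelfAdjoint.spectrum_average_subset [PartialOrder A] [StarOrderedRing A]
    {h : A} (hh : IsSelfAdjoint h) (u : unitary A) :
    spectrum ℝ ((3 : ℝ)⁻¹ • h + (2 / 3 : ℝ) • ((u : A) * h * star (u : A))) ⊆
      Icc (sInf (spectrum ℝ h)) (sSup (spectrum ℝ h)) := by
  have hk : IsSelfAdjoint ((u : A) * h * star (u : A)) := hh.conjugate u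
  have hT : IsSelfAdjoint ((3 : ℝ)⁻¹ • h + (2 / 3 : ℝ) • ((u : A) * h * star (u : A))) :=
    ((IsSelfAdjoint.all _).smul hh).add ((IsSelfAdjoint.all _).smul hk)
  have hconst : ∀ r : ℝ, (u : A) * algebraMap ℝ A r * star (u : A) = algebraMap ℝ A r := fun r => by
    rw [← Algebra.commutes, mul_assoc, Unitary.mul_star_self_of_mem u.2, mul_one]
  have hsum : ∀ r : ℝ, (3 : ℝ)⁻¹ • algebraMap ℝ A r + (2 / 3 : ℝ) • algebraMap ℝ A r =
      algebraMap ℝ A r := fun r => by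
    rw [← add_smul]; norm_num
  refine fun t ht => ⟨(algebraMap_le_iff_le_spectrum hT).1 ?_ t ht,
    (le_algebraMap_iff_spectrum_le hT).1 ?_ t ht⟩
  · rw [← hsum, ← hconst]
    have h1 := hh.algebraMap_sInf_le
    have h2 := star_right_conjugate_le_conjugate h1 (u : A)
    nth_rewrite 1 [hconst]
    exact add_le_add (smul_le_smul_of_nonneg_left h1 (by norm_num))
      (smul_le_smul_of_nonneg_left h2 (by norm_num))
  · rw [← hsum, ← hconst]
    have h1 := hh.le_algebraMap_sSup
    have h2 := star_right_conjugate_le_conjugate h1 (u : A)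
    nth_rewrite 1 [hconst]
    exact add_le_add (smul_le_smul_of_nonneg_left h1 (by norm_num))
      (smul_le_smul_of_nonneg_left h2 (by norm_num))

theorem norm_average_sub_le {h y v z : A} {u : unitary A} {η a b : ℝ}
    (hz : (u : A) * z = y) (hz' : star (u : A) * y = z) (hzv : z = -Complex.I • v)
    (hvy : ‖v‖ = ‖y‖) (ha : ‖h * y - a • y‖ ≤ η * ‖y‖) (hb : ‖h * v - b • v‖ ≤ η * ‖v‖) :
    ‖((3 : ℝ)⁻¹ • h + (2 / 3 : ℝ) • ((u : A) * h * star (u : A))) * y - (a / 3 + 2 * b / 3) • y‖ ≤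
      η * ‖y‖ := by
  have hb' : ‖(u : A) * (h * z - b • z)‖ ≤ η * ‖y‖ := by
    rw [CStarRing.norm_coe_unitary_mul, hzv, mul_smul_comm, smul_comm b, ← smul_sub, norm_smul,
      ← hvy]
    simpa using hb
  have heq : ((3 : ℝ)⁻¹ • h + (2 / 3 : ℝ) • ((u : A) * h * star (u : A))) * y -
      (a / 3 + 2 * b / 3) • y =
      (3 : ℝ)⁻¹ • (h * y - a • y) + (2 / 3 : ℝ) • ((u : A) * (h * z - b • z)) := by
    rw [add_mul, smul_mul_assoc, smul_mul_assoc, mul_assoc, mul_assoc, hz', mul_sub, mul_smul_comm,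
      hz]
    module
  rw [heq]
  refine (norm_add_le _ _).trans ?_
  rw [norm_smul, norm_smul, Real.norm_of_nonneg (by norm_num), Real.norm_of_nonneg (by norm_num)]
  linarith

theorem IsSimpleCStarAlgebra.exists_unitary_spectrumHasGapsAtMost [PartialOrder A]
    [StarOrderedRing A] [Nontrivial A] (hA : IsSimpleCStarAlgebra A)
    {h : A} (hh : IsSelfAdjoint h) {ε : ℝ} (hε : 0 < ε) :
    ∃ u : unitary A,
      SpectrumHasGapsAtMost ((3 : ℝ)⁻¹ • h + (2 / 3 : ℝ) • ((u : A) * h * star (u : A)))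
        (omegaSpec h / 3 + ε) := by
  set l := sInf (spectrum ℝ h) with hl
  set r := sSup (spectrum ℝ h) with hr
  have hls : l ∈ spectrum ℝ h := hh.sInf_mem_spectrum
  have hrs : r ∈ spectrum ℝ h := hh.sSup_mem_spectrum
  have hω : omegaSpec h = r - l := rfl
  have hlr : l ≤ r := csInf_le (ContinuousFunctionalCalculus.isCompact_spectrum h).bddBelow hrs
  have hT : ∀ u : unitary A,
      IsSelfAdjoint ((3 : ℝ)⁻¹ • h + (2 / 3 : ℝ) • ((u : A) * h * star (u : A))) := fun u =>
    ((IsSelfAdjoint.all _).smul hh).add ((IsSelfAdjoint.all _).smul (hh.conjugate u))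
  have hbound : ∀ u : unitary A, ∀ s t : ℝ,
      sInf (spectrum ℝ ((3 : ℝ)⁻¹ • h + (2 / 3 : ℝ) • ((u : A) * h * star (u : A)))) ≤ s →
      t ≤ sSup (spectrum ℝ ((3 : ℝ)⁻¹ • h + (2 / 3 : ℝ) • ((u : A) * h * star (u : A)))) →
      l ≤ s ∧ t ≤ r := fun u s t hs ht =>
    ⟨(hh.spectrum_average_subset u (hT u).sInf_mem_spectrum).1.trans hs,
      ht.trans (hh.spectrum_average_subset u (hT u).sSup_mem_spectrum).2⟩
  rcases hlr.eq_or_lt with heq | hlt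
  · refine ⟨1, fun s t hs ht hst => ?_⟩
    obtain ⟨h1, h2⟩ := hbound 1 s t hs ht
    rw [hω] at hst
    linarith
  obtain ⟨ρ, hρ, hρε, hρlr⟩ : ∃ ρ > 0, ρ ≤ ε / 4 ∧ ρ ≤ (r - l) / 2 :=
    ⟨min (ε / 4) ((r - l) / 2), lt_min (by linarith) (by linarith), min_le_left _ _,
      min_le_right _ _⟩
  obtain ⟨w, y, hy, hy0, hwy, hww, hqw, hwp⟩ := hA.exists_mul_self_eq_zero
    (p := cfc (plateau l ρ) h) (f := cfc (tent l ρ) h) (q := cfc (plateau r ρ) h)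
    (g := cfc (tent r ρ) h) (cfc_predicate _ _) (cfc_predicate _ _) (cfc_tent_ne_zero hh hls ρ)
    (cfc_tent_ne_zero hh hrs ρ) (cfc_plateau_mul_cfc_tent hρ h) (cfc_plateau_mul_cfc_tent hρ h) (by
      rw [← cfc_mul _ _ h (continuous_tent l ρ).continuousOn (continuous_tent r ρ).continuousOn,
        ← cfc_zero ℝ h]
      refine cfc_congr fun t _ => ?_
      rcases le_total ρ |t - l| with h1 | h1
      · simp only [tent_eq_zero hρ h1, zero_mul]; rfl
      · have h2 : ρ ≤ |t - r| := by
          have := (abs_le.1 h1).2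
          rw [abs_sub_comm]
          exact le_trans (by linarith) (le_abs_self _)
        simp only [tent_eq_zero hρ h2, mul_zero]; rfl)
  set v := w * y with hv
  have hwv : star w * v = y := by rw [hv, ← mul_assoc, hwy]
  have hwv0 : w * v = 0 := by rw [hv, ← mul_assoc, hww, zero_mul]
  have hsy : star w * y = 0 := by
    have : star w * star w = 0 := by rw [← star_mul, hww, star_zero]
    rw [← hwy, ← mul_assoc, ← mul_assoc, this, zero_mul, zero_mul]
  have hdy : (w + star w) * y = v := by rw [add_mul, hsy, add_zero]
  have hdv : (w + star w) * v = y := by rw [add_mul, hwv0, hwv, zero_add]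
  obtain ⟨u, hu⟩ := (IsSelfAdjoint.add_star_self w).exists_unitary_mul_eq
  obtain ⟨huy, huy'⟩ := hu y (by rw [hdy, hdv])
  obtain ⟨huv, huv'⟩ := hu v (by rw [hdv, hdy])
  rw [hdy] at huy huy'
  rw [hdv] at huv huv'
  have hnorm : ‖v‖ = ‖y‖ := by
    have h1 : star v * v = star y * y := by rw [hv, star_mul, mul_assoc, ← hv, hwv]
    have h2 := CStarRing.norm_star_mul_self (x := v)
    rw [h1, CStarRing.norm_star_mul_self] at h2
    exact ((mul_self_inj (norm_nonneg _) (norm_nonneg _)).1 h2).symm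
  have hv0 : v ≠ 0 := by
    rw [← norm_pos_iff, hnorm, norm_pos_iff]; exact hy0
  have hpy : cfc (plateau l ρ) h * y = y := by
    have h1 : cfc (plateau l ρ) h * star w = star w := by
      have := congrArg star hwp
      rwa [star_mul, (cfc_predicate (plateau l ρ) h : IsSelfAdjoint _).star_eq] at this
    rw [← hwv, ← mul_assoc, h1]
  have hqv : cfc (plateau r ρ) h * v = v := by rw [hv, ← mul_assoc, hqw]
  have hny := norm_mul_sub_smul_le_of_plateau_mul hh hρ hpy
  have hnv := norm_mul_sub_smul_le_of_plateau_mul hh hρ hqv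
  have hII : ∀ x : A, -Complex.I • Complex.I • x = x := fun x => by
    rw [smul_smul, neg_mul, Complex.I_mul_I, neg_neg, one_smul]
  have hy1 := norm_average_sub_le (u := u) (z := -Complex.I • v)
    (by rw [mul_smul_comm, huv, hII]) huy' rfl hnorm hny hnv
  have hv1 := norm_average_sub_le (u := u) (z := -Complex.I • y)
    (by rw [mul_smul_comm, huy, hII]) huv' rfl hnorm.symm hnv hny
  obtain ⟨ν, hν, hνd⟩ := exists_mem_spectrum_abs_sub_le (hT u) hy0 (by positivity) hy1
  obtain ⟨κ, hκ, hκd⟩ := exists_mem_spectrum_abs_sub_le (hT u) hv0 (by positivity) hv1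
  refine ⟨u, fun s t hs ht hst => ?_⟩
  obtain ⟨h1, h2⟩ := hbound u s t hs ht
  rw [hω] at hst
  rw [abs_le] at hνd hκd
  by_cases hc : s ≤ (r / 3 + 2 * l / 3) - 2 * ρ
  · exact ⟨κ, ⟨by linarith, by linarith⟩, hκ⟩
  · push Not at hc
    exact ⟨ν, ⟨by linarith, by linarith⟩, hν⟩

end Averaging

/-! ### Perturbation by a commutator -/

section Commutator

open Set Filter Topology

theorem exists_finset_Icc_subset_iUnion_closedBall {K : Set ℝ} (hK : IsCompact K)
    (hne : K.Nonempty) {δ : ℝ} (hδ : 0 < δ)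
    (hgap : ∀ s t : ℝ, sInf K ≤ s → t ≤ sSup K → t - s = δ → ∃ x ∈ Icc s t, x ∈ K) :
    ∃ F : Finset ℝ, ↑F ⊆ K ∧
      ∀ t ∈ Icc (sInf K - δ / 2) (sSup K + δ / 2), ∃ p ∈ F, |t - p| ≤ δ / 2 := by
  classical
  set l := sInf K
  set r := sSup K
  set S := {m ∈ K | ∃ F : Finset ℝ, ↑F ⊆ K ∧ ∀ t ∈ Icc (l - δ / 2) (m + δ / 2),
    ∃ p ∈ F, |t - p| ≤ δ / 2} with hS
  have hlS : l ∈ S := by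
    refine ⟨hK.sInf_mem hne, {l}, by simpa using hK.sInf_mem hne, fun t ht => ⟨l, by simp, ?_⟩⟩
    rw [abs_le]
    constructor <;> linarith [ht.1, ht.2]
  have hstep : ∀ m ∈ S, ∀ k ∈ K, k ≤ m + δ → k ∈ S := by
    rintro m ⟨-, F, hFK, hF⟩ k hk hkm
    refine ⟨hk, insert k F, by simpa [insert_subset_iff] using ⟨hk, hFK⟩, fun t ht => ?_⟩
    rcases le_or_gt t (m + δ / 2) with h | h
    · obtain ⟨p, hp, hpt⟩ := hF t ⟨ht.1, h⟩
      exact ⟨p, Finset.mem_insert_of_mem hp, hpt⟩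
    · refine ⟨k, Finset.mem_insert_self _ _, abs_le.2 ⟨?_, ?_⟩⟩ <;> linarith [ht.2]
  have hSK : S ⊆ K := fun m hm => hm.1
  have hSb : BddAbove S := hK.bddAbove.mono hSK
  set s := sSup S with hs
  have hsK : s ∈ K :=
    hK.isClosed.closure_subset_iff.2 hSK (csSup_mem_closure ⟨l, hlS⟩ hSb)
  have hsS : s ∈ S := by
    obtain ⟨a, ha, hlt⟩ := exists_lt_of_lt_csSup ⟨l, hlS⟩ (sub_lt_self s hδ)
    exact hstep a ha s hsK (by linarith)
  suffices hrs : r ≤ s by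
    obtain ⟨-, F, hFK, hF⟩ := hsS
    exact ⟨F, hFK, fun t ht => hF t ⟨ht.1, by linarith [ht.2]⟩⟩
  by_contra! hsr
  have hno : ∀ k ∈ K, k ≤ s + δ → k ≤ s := fun k hk hks => le_csSup hSb (hstep s hsS k hk hks)
  have hrK : r ∈ K := hK.sSup_mem hne
  have hrs : s + δ < r := by
    by_contra! h
    exact absurd (hno r hrK h) hsr.not_ge
  have hK' : IsCompact (K ∩ Ici (s + δ)) := hK.inter_right isClosed_Ici
  set m := sInf (K ∩ Ici (s + δ)) with hm
  have hmem : m ∈ K ∩ Ici (s + δ) := hK'.sInf_mem ⟨r, hrK, hrs.le⟩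
  have hmlt : s + δ < m := lt_of_le_of_ne hmem.2 fun h => by
    have := hno m hmem.1 h.ge
    linarith
  have hmr : m ≤ r := csInf_le hK'.bddBelow ⟨hrK, hrs.le⟩
  have hls : l ≤ s := csInf_le hK.bddBelow hsK
  obtain ⟨x, hx, hxK⟩ := hgap ((s + (m - δ)) / 2) ((s + (m - δ)) / 2 + δ) (by linarith)
    (by linarith) (by ring)
  rcases le_or_gt x (s + δ) with h | h
  · linarith [hno x hxK h, hx.1]
  · have : m ≤ x := csInf_le hK'.bddBelow ⟨hxK, h.le⟩
    linarith [hx.2]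

/-- The function moving the points close to `F` to the nearest point of `F`. -/
def collapse (F : Finset ℝ) (ρ t : ℝ) : ℝ := t - ∑ p ∈ F, (t - p) * plateau p (2 * ρ) t

theorem continuous_collapse (F : Finset ℝ) (ρ : ℝ) : Continuous (collapse F ρ) := by
  have := fun p => continuous_plateau p (2 * ρ)
  unfold collapse; fun_prop

theorem collapse_eq_of_abs_sub_le {F : Finset ℝ} {ρ : ℝ} (hρ : 0 < ρ)
    (hF : ∀ p ∈ F, ∀ q ∈ F, p ≠ q → 8 * ρ ≤ |p - q|) {p t : ℝ} (hp : p ∈ F)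
    (ht : |t - p| ≤ 4 * ρ) : collapse F ρ t = t - (t - p) * plateau p (2 * ρ) t := by
  rw [collapse, Finset.sum_eq_single_of_mem p hp]
  intro q hq hqp
  have h1 := hF q hq p hp hqp
  have h2 := abs_sub_le q t p
  rw [abs_sub_comm q t] at h2
  rw [plateau_eq_zero (by positivity) (by linarith), mul_zero]

theorem collapse_eq_self_or {F : Finset ℝ} {ρ : ℝ} (hρ : 0 < ρ)
    (hF : ∀ p ∈ F, ∀ q ∈ F, p ≠ q → 8 * ρ ≤ |p - q|) (t : ℝ) :
    collapse F ρ t = t ∨ ∃ p ∈ F, collapse F ρ t = t - (t - p) * plateau p (2 * ρ) t := by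
  by_cases h : ∃ p ∈ F, |t - p| ≤ 4 * ρ
  · obtain ⟨p, hp, hpt⟩ := h
    exact Or.inr ⟨p, hp, collapse_eq_of_abs_sub_le hρ hF hp hpt⟩
  · push Not at h
    left
    rw [collapse, Finset.sum_eq_zero, sub_zero]
    intro p hp
    rw [plateau_eq_zero (by positivity) (by linarith [h p hp]), mul_zero]

theorem abs_sub_collapse_le {F : Finset ℝ} {ρ : ℝ} (hρ : 0 < ρ)
    (hF : ∀ p ∈ F, ∀ q ∈ F, p ≠ q → 8 * ρ ≤ |p - q|) (t : ℝ) :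
    |t - collapse F ρ t| ≤ 4 * ρ := by
  rcases collapse_eq_self_or hρ hF t with h | ⟨p, -, h⟩
  · rw [h, sub_self, abs_zero]; positivity
  · rw [h, sub_sub_cancel]
    exact (abs_sub_mul_plateau_le (by positivity) t).trans (by linarith)

theorem collapse_mem_Icc {F : Finset ℝ} {ρ : ℝ} (hρ : 0 < ρ)
    (hF : ∀ p ∈ F, ∀ q ∈ F, p ≠ q → 8 * ρ ≤ |p - q|) {l r t : ℝ} (hFI : ∀ p ∈ F, p ∈ Icc l r)
    (ht : t ∈ Icc l r) : collapse F ρ t ∈ Icc l r := by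
  rcases collapse_eq_self_or hρ hF t with h | ⟨p, hp, h⟩
  · rwa [h]
  · rw [h, show t - (t - p) * plateau p (2 * ρ) t =
      (1 - plateau p (2 * ρ) t) • t + plateau p (2 * ρ) t • p by simp only [smul_eq_mul]; ring]
    exact convex_Icc l r ht (hFI p hp) (sub_nonneg.2 (plateau_le_one _ _ _))
      (plateau_nonneg _ _ _) (by ring)

theorem collapse_mul_plateau {F : Finset ℝ} {ρ : ℝ} (hρ : 0 < ρ)
    (hF : ∀ p ∈ F, ∀ q ∈ F, p ≠ q → 8 * ρ ≤ |p - q|) {p : ℝ} (hp : p ∈ F) (t : ℝ) :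
    collapse F ρ t * plateau p ρ t = p * plateau p ρ t := by
  rcases le_total (2 * ρ) |t - p| with h | h
  · rw [plateau_eq_zero hρ h, mul_zero, mul_zero]
  · rw [collapse_eq_of_abs_sub_le hρ hF hp (by linarith), plateau_eq_one (by positivity) h]
    ring

theorem plateau_mul_plateau {p q ρ : ℝ} (hρ : 0 < ρ) (hpq : 8 * ρ ≤ |p - q|) (t : ℝ) :
    plateau p ρ t * plateau q ρ t = 0 := by
  rcases le_total (2 * ρ) |t - p| with h | h
  · rw [plateau_eq_zero hρ h, zero_mul]
  · have h2 := abs_sub_le p t q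
    rw [abs_sub_comm p t] at h2
    rw [plateau_eq_zero (s := q) hρ (by linarith), mul_zero]

theorem exists_pos_forall_le_abs_sub (F : Finset ℝ) {ε : ℝ} (hε : 0 < ε) :
    ∃ ρ > 0, 4 * ρ < ε ∧ ∀ p ∈ F, ∀ q ∈ F, p ≠ q → 8 * ρ ≤ |p - q| := by
  have hlt : ∀ c d : ℝ, 0 < d → ∀ᶠ ρ : ℝ in 𝓝[>] 0, c * ρ < d := fun c d hd => by
    have h0 : Tendsto (fun ρ : ℝ => c * ρ) (𝓝 0) (𝓝 0) := by
      have : Continuous fun ρ : ℝ => c * ρ := by fun_prop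
      simpa using this.tendsto 0
    exact (tendsto_nhdsWithin_of_tendsto_nhds h0).eventually (gt_mem_nhds hd)
  have h2 : ∀ᶠ ρ : ℝ in 𝓝[>] 0, ∀ x ∈ F.offDiag, 8 * ρ < |x.1 - x.2| :=
    (Finset.eventually_all F.offDiag).2 fun x hx =>
      hlt _ _ (abs_pos.2 (sub_ne_zero.2 (Finset.mem_offDiag.1 hx).2.2))
  obtain ⟨ρ, ⟨h1, h2⟩, hρ⟩ := (((hlt 4 ε hε).and h2).and self_mem_nhdsWithin).exists
  exact ⟨ρ, hρ, h1, fun p hp q hq hpq => (h2 (p, q) (Finset.mem_offDiag.2 ⟨hp, hq, hpq⟩)).le⟩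

theorem norm_eq_one_of_spectrum_eq_Icc [PartialOrder A] [StarOrderedRing A] [Nontrivial A]
    {a : A} (ha : 0 ≤ a) (h : spectrum ℝ a = Icc 0 1) : ‖a‖ = 1 := by
  have h1 : ‖a‖ ∈ spectrum ℝ a :=
    CStarAlgebra.norm_mem_spectrum_of_nonneg ha
  have h2 : (1 : ℝ) ∈ spectrum ℝ a := h ▸ right_mem_Icc.2 zero_le_one
  have h3 := spectrum.norm_le_norm_of_mem h2
  rw [norm_one] at h3
  exact le_antisymm (h ▸ h1).2 h3

theorem sub_mul_mem_spectrum_of_mul_eq {k d e w : A} (hk : IsSelfAdjoint k)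
    (hd : IsSelfAdjoint d) (hw : IsSelfAdjoint w) {p c s : ℝ} (hke : k * e = p • e)
    (hew : e * w = w) (hdw : d * w = c • (w * w))
    (hs : s ∈ closure (spectrum ℝ w \ {0})) : p - c * s ∈ spectrum ℝ (k - d) := by
  refine mem_spectrum_of_forall_approx (hk.sub hd) fun η hη => ?_
  have hc : 0 < |c| + 1 := by positivity
  obtain ⟨y, hy, hle⟩ := exists_approx_eigenvector hw hs (div_pos hη hc)
  refine ⟨w * y, hy, ?_⟩
  have hkw : k * w = p • w := by rw [← hew, ← mul_assoc, hke, smul_mul_assoc]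
  have heq : (k - d) * (w * y) - (p - c * s) • (w * y) =
      -c • (w * (w * y) - s • (w * y)) := by
    rw [sub_mul, ← mul_assoc, hkw, ← mul_assoc, hdw, smul_mul_assoc, smul_mul_assoc, mul_assoc w w]
    module
  rw [heq, norm_smul, norm_neg, Real.norm_eq_abs]
  calc |c| * ‖w * (w * y) - s • (w * y)‖ ≤ (|c| + 1) * (η / (|c| + 1) * ‖w * y‖) := by
        gcongr; linarith
    _ = η * ‖w * y‖ := by field_simp

theorem exists_spectrum_sub_commutator_eq_Icc [PartialOrder A] [StarOrderedRing A] [Nontrivial A]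
    {ι : Type*} [Fintype ι] [Nonempty ι] {k : A} (hk : IsSelfAdjoint k) {l r δ : ℝ} (hδ : 0 < δ)
    (hkl : algebraMap ℝ A l ≤ k) (hkr : k ≤ algebraMap ℝ A r) {p : ι → ℝ}
    (hp : ∀ t ∈ Icc (l - δ / 2) (r + δ / 2), ∃ i, |t - p i| ≤ δ / 2) {e x : ι → A}
    (he : ∀ i, IsSelfAdjoint (e i)) (hee : Pairwise fun i j => e i * e j = 0)
    (hke : ∀ i, k * e i = p i • e i) (hex : ∀ i, e i * x i = x i) (hxe : ∀ i, x i * e i = x i)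
    (hxx : ∀ i, x i * x i = 0) (hsp : ∀ i, spectrum ℝ (star (x i) * x i) = Icc 0 1) :
    ∃ y : A, ‖y‖ ^ 2 = δ / 2 ∧ y * y = 0 ∧
      spectrum ℝ (k - (star y * y - y * star y)) = Icc (l - δ / 2) (r + δ / 2) := by
  have hex' : ∀ i, e i * star (x i) = star (x i) := fun i => by
    rw [← (he i).star_eq, ← star_mul, hxe]
  have hxe' : ∀ i, star (x i) * e i = star (x i) := fun i => by
    rw [← (he i).star_eq, ← star_mul, hex]
  have horth : ∀ {i j}, i ≠ j → ∀ {a b : A}, a * e i = a → e j * b = b → a * b = 0 :=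
    fun {i j} hij {a b} ha hb => by
      rw [← ha, ← hb, mul_assoc, ← mul_assoc (e i), hee hij, zero_mul, mul_zero]
  have hsum : ∀ a b : ι → A, (∀ i, a i * e i = a i) → (∀ i, e i * b i = b i) →
      (∑ i, a i) * (∑ i, b i) = ∑ i, a i * b i := fun a b ha hb => by
    rw [Finset.sum_mul_sum]
    refine Finset.sum_congr rfl fun i _ => Finset.sum_eq_single i (fun j _ hji => ?_) (by simp)
    exact horth hji.symm (ha i) (hb j)
  have hpos : ∀ i, 0 ≤ star (x i) * x i := fun i => star_mul_self_nonneg _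
  set X := ∑ i, x i with hX
  have hXX : X * X = 0 := by
    rw [hX, hsum x x hxe hex]; simp [hxx]
  have hP : star X * X = ∑ i, star (x i) * x i := by
    rw [hX, star_sum, hsum _ x hxe' hex]
  have hQ : X * star X = ∑ i, x i * star (x i) := by
    rw [hX, star_sum, hsum x _ hxe hex']
  have hnorm : ‖star X * X‖₊ = 1 := by
    rw [hP, IsSelfAdjoint.nnnorm_sum_eq_sup _ (fun i _ => (hpos i).isSelfAdjoint)]
    · have : ∀ i, ‖star (x i) * x i‖₊ = 1 := fun i =>
        NNReal.eq (norm_eq_one_of_spectrum_eq_Icc (hpos i) (hsp i))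
      simp only [this]
      exact Finset.sup_const Finset.univ_nonempty _
    · intro i j hij
      exact horth hij (by rw [mul_assoc, hxe]) (by rw [← mul_assoc, hex'])
  set c := √(δ / 2) with hc
  have hcc : c * c = δ / 2 := Real.mul_self_sqrt (by positivity)
  have hyP : star (c • X) * (c • X) = (δ / 2) • (star X * X) := by
    rw [star_smul, smul_mul_smul_comm, star_trivial, hcc]
  have hyQ : (c • X) * star (c • X) = (δ / 2) • (X * star X) := by
    rw [star_smul, smul_mul_smul_comm, star_trivial, hcc]
  have hny : ‖c • X‖ ^ 2 = δ / 2 := by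
    rw [sq, ← CStarRing.norm_star_mul_self, hyP, norm_smul, ← coe_nnnorm (star X * X), hnorm,
      Real.norm_of_nonneg (by positivity), NNReal.coe_one, mul_one]
  have hd : IsSelfAdjoint (star (c • X) * (c • X) - (c • X) * star (c • X)) :=
    (IsSelfAdjoint.star_mul_self _).sub (IsSelfAdjoint.mul_star_self _)
  refine ⟨c • X, hny, by rw [smul_mul_smul_comm, hXX, smul_zero], Subset.antisymm ?_ ?_⟩
  · have h1 : star (c • X) * (c • X) ≤ algebraMap ℝ A (δ / 2) :=
      hny ▸ CStarAlgebra.star_mul_le_algebraMap_norm_sq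
    have h2 : (c • X) * star (c • X) ≤ algebraMap ℝ A (δ / 2) :=
      hny ▸ CStarAlgebra.mul_star_le_algebraMap_norm_sq
    have h3 : 0 ≤ star (c • X) * (c • X) := star_mul_self_nonneg _
    have h4 : 0 ≤ (c • X) * star (c • X) := mul_star_self_nonneg _
    refine fun t ht => ⟨(algebraMap_le_iff_le_spectrum (hk.sub hd)).1 ?_ t ht,
      (le_algebraMap_iff_spectrum_le (hk.sub hd)).1 ?_ t ht⟩
    · rw [map_sub]
      refine sub_le_sub hkl ?_
      simpa using sub_le_sub h1 h4
    · rw [map_add, sub_eq_add_neg, neg_sub]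
      refine add_le_add hkr ?_
      simpa using sub_le_sub h2 h3
  · intro t ht
    obtain ⟨i, hi⟩ := hp t ht
    have hcl : ∀ s ∈ Icc (0 : ℝ) 1, s ∈ closure (Icc (0 : ℝ) 1 \ {0}) := by
      rw [Icc_sdiff_left, closure_Ioc zero_ne_one]
      exact fun s hs => hs
    have hone : ∀ (a : ι → A) (b : A), (∀ j, a j * e j = a j) → e i * b = b →
        (∑ j, a j) * b = a i * b := fun a b ha hb => by
      rw [Finset.sum_mul]
      exact Finset.sum_eq_single i (fun j _ hji => horth hji (ha j) hb) (by simp)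
    have hPe : ∀ j, star (x j) * x j * e j = star (x j) * x j := fun j => by rw [mul_assoc, hxe]
    have hQe : ∀ j, x j * star (x j) * e j = x j * star (x j) := fun j => by rw [mul_assoc, hxe']
    have heP : e i * (star (x i) * x i) = star (x i) * x i := by rw [← mul_assoc, hex']
    have heQ : e i * (x i * star (x i)) = x i * star (x i) := by rw [← mul_assoc, hex]
    have hQP : x i * star (x i) * (star (x i) * x i) = 0 := by
      rw [mul_assoc, ← mul_assoc (star (x i)), ← star_mul, hxx, star_zero, zero_mul, mul_zero]
    have hPQ : star (x i) * x i * (x i * star (x i)) = 0 := by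
      rw [mul_assoc, ← mul_assoc (x i), hxx, zero_mul, mul_zero]
    obtain ⟨h1, h2⟩ := abs_le.1 hi
    rcases le_total t (p i) with hti | hti
    · have := sub_mul_mem_spectrum_of_mul_eq hk hd (.star_mul_self (x i)) (hke i) heP
        (c := δ / 2) (s := (p i - t) / (δ / 2)) (by
          rw [hyP, hyQ, ← smul_sub, smul_mul_assoc, sub_mul, hP, hQ, hone _ _ hPe heP,
            hone _ _ hQe heP, hQP, sub_zero])
        (by
          rw [hsp]
          exact hcl _ ⟨div_nonneg (by linarith) (by linarith),
            (div_le_one (by linarith)).2 (by linarith)⟩)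
      rwa [mul_div_cancel₀ _ (by positivity), sub_sub_cancel] at this
    · have := sub_mul_mem_spectrum_of_mul_eq hk hd (.mul_star_self (x i)) (hke i) heQ
        (c := -(δ / 2)) (s := (t - p i) / (δ / 2)) (by
          rw [hyP, hyQ, ← smul_sub, smul_mul_assoc, sub_mul, hP, hQ, hone _ _ hPe heQ,
            hone _ _ hQe heQ, hPQ, zero_sub, smul_neg, neg_smul])
        (by
          rw [← spectrum.nonzero_mul_comm, hsp]
          exact hcl _ ⟨div_nonneg (by linarith) (by linarith),
            (div_le_one (by linarith)).2 (by linarith)⟩)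
      rwa [neg_mul, mul_div_cancel₀ _ (by positivity), sub_neg_eq_add, add_sub_cancel] at this

theorem IsSimpleCStarAlgebra.exists_commutator_spectrum_eq_Icc [PartialOrder A]
    [StarOrderedRing A] [Nontrivial A] (hA : IsSimpleCStarAlgebra A)
    (hinf : ¬ FiniteDimensional ℂ A) {h : A} (hh : IsSelfAdjoint h) {ε δ : ℝ} (hε : 0 < ε)
    (hδ : 0 < δ) (hgap : SpectrumHasGapsAtMost h δ) :
    ∃ k x : A, IsSelfAdjoint k ∧ ‖x‖ ^ 2 = δ / 2 ∧ x * x = 0 ∧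
      ‖h - (k + (star x * x - x * star x))‖ < ε ∧
      spectrum ℝ k = Icc (sInf (spectrum ℝ h) - δ / 2) (sSup (spectrum ℝ h) + δ / 2) := by
  have hK := ContinuousFunctionalCalculus.isCompact_spectrum (R := ℝ) h
  obtain ⟨F, hFK, hF⟩ := exists_finset_Icc_subset_iUnion_closedBall hK
    (ContinuousFunctionalCalculus.spectrum_nonempty h hh) hδ hgap
  obtain ⟨ρ, hρ, hρε, hsep⟩ := exists_pos_forall_le_abs_sub F hε
  have hKI : ∀ t ∈ spectrum ℝ h, t ∈ Icc (sInf (spectrum ℝ h)) (sSup (spectrum ℝ h)) :=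
    fun t ht => ⟨csInf_le hK.bddBelow ht, le_csSup hK.bddAbove ht⟩
  have hcol := continuous_collapse F ρ
  have hcolI : ∀ t ∈ spectrum ℝ h, collapse F ρ t ∈
      Icc (sInf (spectrum ℝ h)) (sSup (spectrum ℝ h)) := fun t ht =>
    collapse_mem_Icc hρ hsep (fun p hp => hKI p (hFK hp)) (hKI t ht)
  have hk : IsSelfAdjoint (cfc (collapse F ρ) h) := cfc_predicate _ _
  have hkspec : ∀ t ∈ spectrum ℝ (cfc (collapse F ρ) h),
      t ∈ Icc (sInf (spectrum ℝ h)) (sSup (spectrum ℝ h)) := by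
    rw [cfc_map_spectrum (collapse F ρ) h]
    rintro _ ⟨t, ht, rfl⟩
    exact hcolI t ht
  have hpl := fun p => continuous_plateau p ρ
  have hex : ∀ p : F, ∃ x : A, cfc (plateau p ρ) h * x = x ∧ x * cfc (plateau p ρ) h = x ∧
      x * x = 0 ∧ spectrum ℝ (star x * x) = Icc 0 1 := fun p =>
    hA.exists_mul_self_eq_zero_spectrum_eq_Icc hinf (cfc_predicate _ _) (cfc_predicate _ _)
      (cfc_tent_ne_zero hh (hFK p.2) ρ) (cfc_plateau_mul_cfc_tent hρ h)
  choose x hex hxe hxx hsp using hex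
  have : Nonempty F := by
    obtain ⟨s, hs⟩ := ContinuousFunctionalCalculus.spectrum_nonempty (R := ℝ) h hh
    obtain ⟨p, hp, -⟩ := hF s ⟨by linarith [(hKI s hs).1], by linarith [(hKI s hs).2]⟩
    exact ⟨⟨p, hp⟩⟩
  obtain ⟨y, hy, hyy, hspec⟩ := exists_spectrum_sub_commutator_eq_Icc hk hδ
    ((algebraMap_le_iff_le_spectrum hk).2 fun t ht => (hkspec t ht).1)
    ((le_algebraMap_iff_spectrum_le hk).2 fun t ht => (hkspec t ht).2)
    (p := fun p : F => (p : ℝ)) (fun t ht => by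
      obtain ⟨p, hp, hpt⟩ := hF t ht
      exact ⟨⟨p, hp⟩, hpt⟩)
    (fun p => cfc_predicate (plateau p ρ) h)
    (fun p q hpq => by
      beta_reduce
      rw [← cfc_mul _ _ h (hpl _).continuousOn (hpl _).continuousOn, ← cfc_zero ℝ h]
      exact cfc_congr fun t _ => plateau_mul_plateau hρ
        (hsep p p.2 q q.2 (Subtype.coe_injective.ne hpq)) t)
    (fun p => by
      rw [← cfc_mul _ _ h hcol.continuousOn (hpl _).continuousOn,
        ← cfc_const_mul (p : ℝ) _ h (hpl _).continuousOn]
      exact cfc_congr fun t _ => collapse_mul_plateau hρ hsep p.2 t)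
    hex hxe hxx hsp
  refine ⟨_, y, hk.sub ((IsSelfAdjoint.star_mul_self y).sub (.mul_star_self y)), hy, hyy, ?_, hspec⟩
  rw [sub_add_cancel]
  have heq : h - cfc (collapse F ρ) h = cfc (fun t => t - collapse F ρ t) h := by
    rw [cfc_sub (fun t : ℝ => t) (collapse F ρ) h, cfc_id' ℝ h]
  rw [heq]
  exact (norm_cfc_le (by positivity) fun t _ => abs_sub_collapse_le hρ hsep t).trans_lt hρε

end Commutator

/-- **Lemma 4.6.**  Let `A` be simple, unital and non-elementary (infinite-dimensional), let
`h ∈ A` be self-adjoint and let `ε > 0`.  (i) There is a unitary `u` such that the spectrum of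
`(1/3)h + (2/3)u h u*` has gaps of size at most `ω(h)/3 + ε`.  (ii) If the spectrum of `h`
has gaps of size at most `δ > 0`, there exist a self-adjoint `h̃` and `x ∈ A` with
`‖x‖² = δ/2`, `x² = 0`, `‖h − (h̃ + [x*, x])‖ < ε`, and `sp(h̃) = [l(h) − δ/2, r(h) + δ/2]`. -/
theorem simple_nonelementary_gaps (A : Type*) [CStarAlgebra A]
    (hsimple : IsSimpleCStarAlgebra A) (hinfdim : ¬ FiniteDimensional ℂ A)
    (h : A) (hsa : IsSelfAdjoint h) (ε : ℝ) (hε : 0 < ε) :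
    (∃ u : unitary A,
      SpectrumHasGapsAtMost ((3 : ℝ)⁻¹ • h + (2 / 3 : ℝ) • ((u : A) * h * star (u : A)))
        (omegaSpec h / 3 + ε)) ∧
    (∀ δ : ℝ, 0 < δ → SpectrumHasGapsAtMost h δ →
      ∃ ht x : A, IsSelfAdjoint ht ∧ ‖x‖ ^ 2 = δ / 2 ∧ x * x = 0 ∧
        ‖h - (ht + (star x * x - x * star x))‖ < ε ∧
        spectrum ℝ ht =
          Set.Icc (sInf (spectrum ℝ h) - δ / 2) (sSup (spectrum ℝ h) + δ / 2)) := by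
  have hnt : Nontrivial A := by
    by_contra hn
    have : Subsingleton A := not_nontrivial_iff_subsingleton.1 hn
    exact hinfdim inferInstance
  let _ : PartialOrder A := CStarAlgebra.spectralOrder A
  have : StarOrderedRing A := CStarAlgebra.spectralOrderedRing A
  exact ⟨hsimple.exists_unitary_spectrumHasGapsAtMost hsa hε, fun δ hδ hgap =>
    hsimple.exists_commutator_spectrum_eq_Icc hinfdim hsa hε hδ hgap⟩

end
end
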